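/- arXiv:0711.3832 — 6 statements merged into one kernel-verified Lean document; each statement's English description precedes it below -/
import Mathlib

section
/- Let r > 0 be a real number. Let z : [0,r) → [0,r) be a homeomorphism (for the usual topology) such that z(α) > α for every α ∈ (0,r). Let f be a bijection of [0,r) onto itself such that: f commutes with z (f ∘ z = z ∘ f), f is continuous at 0 (i.e. right-continuous at 0), and f has only finitely many points of discontinuity. Then f is continuous on all of [0,r) (for the usual topology). -/
/-- Let `r > 0`, let `z` be a homeomorphism of `[0,r)` with
`z(α) > α` for all `α ∈ (0,r)`, and let `f` be a bijection of `[0,r)` commuting with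
`z`, continuous at `0`, and with only finitely many points of discontinuity.
Then `f` is continuous. -/
theorem continuous_of_commute_single (r : ℝ) (hr : 0 < r)
    (z : (Set.Ico (0:ℝ) r) ≃ₜ (Set.Ico (0:ℝ) r))
    (hz : ∀ α : Set.Ico (0:ℝ) r, 0 < (α : ℝ) → (α : ℝ) < (z α : ℝ))
    (f : Equiv.Perm (Set.Ico (0:ℝ) r))
    (hcomm : ∀ x, f (z x) = z (f x))
    (h0 : ContinuousAt ⇑f ⟨0, Set.left_mem_Ico.2 hr⟩)
    (hfin : {x | ¬ ContinuousAt ⇑f x}.Finite) :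
    Continuous ⇑f := by
  rw [continuous_iff_continuousAt]
  by_contra! hne
  obtain ⟨m, hm, hmax⟩ := hfin.exists_maximal hne
  have hm0 : 0 < (m : ℝ) := by
    refine lt_of_le_of_ne m.2.1 fun h => hm ?_
    have hm' : m = ⟨0, Set.left_mem_Ico.2 hr⟩ := Subtype.ext h.symm
    exact hm' ▸ h0
  have hlt : m < z m := hz m hm0
  have hzm : ¬ ContinuousAt ⇑f (z m) := by
    intro h
    have hfz : ContinuousAt (⇑f ∘ ⇑z) m := h.comp z.continuous.continuousAt
    rw [show ⇑f ∘ ⇑z = ⇑z ∘ ⇑f from funext hcomm] at hfz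
    exact hm ((z.comp_continuousAt_iff f m).1 hfz)
  exact (hmax hzm hlt.le).not_gt hlt
end

section
/- Let r > 0 be a real number. Let Z be a set of homeomorphisms of [0,r) onto itself (usual topology) such that: z(α) ≥ α for every z ∈ Z and every α ∈ [0,r); the support supp(z) = {α : z(α) ≠ α} is an interval for every z ∈ Z; and the union ⋃_{z∈Z} supp(z) is dense in (0,r). Let f be a bijection of [0,r) onto itself such that: f commutes with every z ∈ Z, f is right-continuous at every point of [0,r), and f has only finitely many points of discontinuity. Then f is continuous on [0,r). -/
section

open Set Topology

section

variable {X : Type*} [LinearOrder X] [TopologicalSpace X] {f : X → X}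

/-- A map commuting with `z` preserves the order relation to points outside the support of `z`. -/
theorem lt_iff_lt_of_mem_support {z : X ≃ₜ X} (hord : ({x | z x ≠ x} : Set X).OrdConnected)
    (hf : f.Injective) (hcomm : ∀ x, f (z x) = z (f x)) {x m : X} (hx : z x ≠ x) (hm : z m = m) :
    f x < m ↔ x < m := by
  have hfx : z (f x) ≠ f x := by
    rw [← hcomm]
    exact hf.ne hx
  constructor
  · intro h
    by_contra! h1
    exact hord.out hfx hx ⟨h.le, h1⟩ hm
  · intro h
    by_contra! h1
    exact hord.out hx hfx ⟨h.le, h1⟩ hm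

/-- A map with finitely many discontinuities is continuous at every point moved by some
expanding homeomorphism which it commutes with. -/
theorem continuousAt_of_mem_support {z : X ≃ₜ X} (hz : ∀ x, x ≤ z x)
    (hcomm : ∀ x, f (z x) = z (f x)) (hfin : {x | ¬ ContinuousAt f x}.Finite) {x : X}
    (hx : z x ≠ x) : ContinuousAt f x := by
  by_contra hd
  have hstep (y : X) (hy : ¬ ContinuousAt f y) : ¬ ContinuousAt f (z y) := by
    contrapose! hy
    have : f = z.symm ∘ (f ∘ z) := by
      ext w
      simp [hcomm]
    rw [this]
    exact z.symm.continuous.continuousAt.comp (hy.comp z.continuous.continuousAt)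
  have horbit (n : ℕ) : ¬ ContinuousAt f (z^[n] x) ∧ z (z^[n] x) ≠ z^[n] x := by
    induction n with
    | zero => exact ⟨hd, hx⟩
    | succ n ih =>
      rw [Function.iterate_succ_apply']
      exact ⟨hstep _ ih.1, z.injective.ne ih.2⟩
  have hmono : StrictMono fun n : ℕ => z^[n] x := by
    refine strictMono_nat_of_lt_succ fun n => ?_
    rw [Function.iterate_succ_apply']
    exact (hz _).lt_of_ne (horbit n).2.symm
  exact infinite_of_injective_forall_mem hmono.injective (fun n => (horbit n).1) hfin

end

variable {X : Type*} [ConditionallyCompleteLinearOrder X] [TopologicalSpace X] [OrderTopology X]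
  [DenselyOrdered X]

/-- A continuous injection on `[a, c]` which increases from `b` to `c` increases from `a` to `b`. -/
theorem le_of_continuousOn_of_injective_of_lt {f : X → X} (hf : f.Injective) {a b c : X}
    (hab : a ≤ b) (hbc : b < c) (hc : ContinuousOn f (Icc a c)) (hlt : f b < f c) :
    f a ≤ f b := by
  by_contra! h
  rcases le_total (f c) (f a) with h1 | h1
  · obtain ⟨t, ht, hft⟩ := intermediate_value_Icc' hab
      (hc.mono (Icc_subset_Icc_right hbc.le)) ⟨hlt.le, h1⟩
    exact (ht.2.trans_lt hbc).ne (hf hft)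
  · obtain ⟨t, ht, hft⟩ := intermediate_value_Icc hbc.le
      (hc.mono (Icc_subset_Icc_left hab)) ⟨h.le, h1⟩
    rw [hf hft] at ht
    exact h.ne (congrArg f (hab.antisymm ht.1)).symm

variable {Z : Set (X ≃ₜ X)} {f : X → X}

/-- If the closed interval `[a, b]` is covered by supports of expanding homeomorphisms commuting
with `f`, then `f a ≤ f b`. -/
theorem le_of_forall_mem_support (hZ : ∀ z ∈ Z, ∀ x, x ≤ z x)
    (hord : ∀ z ∈ Z, ({x | z x ≠ x} : Set X).OrdConnected) (hf : f.Injective)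
    (hcomm : ∀ z ∈ Z, ∀ x, f (z x) = z (f x)) (hfin : {x | ¬ ContinuousAt f x}.Finite) {a b : X}
    (hab : a ≤ b) (hsupp : ∀ x ∈ Icc a b, ∃ z ∈ Z, z x ≠ x) : f a ≤ f b := by
  obtain ⟨z, hz, hzb⟩ := hsupp b ⟨hab, le_rfl⟩
  refine le_of_continuousOn_of_injective_of_lt hf hab ((hZ z hz b).lt_of_ne hzb.symm) ?_ ?_
  · intro x hx
    refine ContinuousAt.continuousWithinAt ?_
    rcases le_total x b with h | h
    · obtain ⟨w, hw, hwx⟩ := hsupp x ⟨hx.1, h⟩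
      exact continuousAt_of_mem_support (hZ w hw) (hcomm w hw) hfin hwx
    · exact continuousAt_of_mem_support (hZ z hz) (hcomm z hz) hfin
        ((hord z hz).out hzb (z.injective.ne hzb) ⟨h, hx.2⟩)
  · refine lt_of_le_of_ne ?_ (hf.ne hzb.symm)
    rw [hcomm z hz]
    exact hZ z hz _

variable [NoMaxOrder X]

/-- A right-continuous map commuting with a family of expanding homeomorphisms whose supports have
dense union fixes every common fixed point of the family. -/
theorem apply_eq_self_of_forall_apply_eq (hZ : ∀ z ∈ Z, ∀ x, x ≤ z x)
    (hord : ∀ z ∈ Z, ({x | z x ≠ x} : Set X).OrdConnected)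
    (hdense : ∀ a b : X, a < b → ∃ x ∈ Ioo a b, ∃ z ∈ Z, z x ≠ x) (hf : f.Injective)
    (hcomm : ∀ z ∈ Z, ∀ x, f (z x) = z (f x)) (hfin : {x | ¬ ContinuousAt f x}.Finite)
    {x : X} (hrc : ContinuousWithinAt f (Ici x) x) (hx : ∀ z ∈ Z, z x = x) : f x = x := by
  have hright (s : Set X) (hs : IsOpen s) (hfx : f x ∈ s) : ∃ u > x, ∀ y ∈ Ioo x u, f y ∈ s := by
    have h : f ⁻¹' s ∈ 𝓝[>] x :=
      (hrc.mono Ioi_subset_Ici_self).preimage_mem_nhdsWithin (hs.mem_nhds hfx)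
    obtain ⟨u, hu, hus⟩ := mem_nhdsGT_iff_exists_Ioo_subset.1 h
    exact ⟨u, hu, fun y hy => hus hy⟩
  have hfx : ∀ z ∈ Z, z (f x) = f x := fun z hz => by rw [← hcomm z hz, hx z hz]
  apply le_antisymm
  · by_contra! hlt
    obtain ⟨y, hy, hfy⟩ : ∃ y ∈ Ioo x (f x), ∃ m < f x, ∀ t ∈ Ioo x y,
        (∃ z ∈ Z, z t ≠ t) → f t ≤ m := by
      by_cases h : ∃ y ∈ Ioo x (f x), ∀ z ∈ Z, z y = y
      · obtain ⟨y, hy, hzy⟩ := h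
        refine ⟨y, hy, y, hy.2, fun t ht ⟨z, hz, hzt⟩ => ?_⟩
        exact ((lt_iff_lt_of_mem_support (hord z hz) hf (hcomm z hz) hzt (hzy z hz)).2 ht.2).le
      · push Not at h
        obtain ⟨y, hy⟩ := exists_between hlt
        obtain ⟨z, hz, hzy⟩ := h y hy
        refine ⟨y, hy, f y, (lt_iff_lt_of_mem_support (hord z hz) hf (hcomm z hz) hzy
          (hfx z hz)).2 hy.2, fun t ht _ => ?_⟩
        exact le_of_forall_mem_support hZ hord hf hcomm hfin ht.2.le
          fun w hw => h w ⟨ht.1.trans_le hw.1, hw.2.trans_lt hy.2⟩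
    obtain ⟨m, hm, hle⟩ := hfy
    obtain ⟨u, hu, hus⟩ := hright (Ioi m) isOpen_Ioi hm
    obtain ⟨t, ht, hzt⟩ := hdense x (min u y) (lt_min hu hy.1)
    have h1 : m < f t := hus t ⟨ht.1, ht.2.trans_le (min_le_left _ _)⟩
    exact (hle t ⟨ht.1, ht.2.trans_le (min_le_right _ _)⟩ hzt).not_gt h1
  · by_contra! hlt
    obtain ⟨u, hu, hus⟩ := hright (Iio x) isOpen_Iio hlt
    obtain ⟨t, ht, z, hz, hzt⟩ := hdense x u hu
    exact ht.1.not_gt ((lt_iff_lt_of_mem_support (hord z hz) hf (hcomm z hz) hzt (hx z hz)).1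
      (hus t ht))

/-- A right-continuous injection with finitely many discontinuities is monotone if it commutes
with a family of expanding homeomorphisms, each supported on an interval, whose supports have
dense union. -/
theorem monotone_of_commute_family (hZ : ∀ z ∈ Z, ∀ x, x ≤ z x)
    (hord : ∀ z ∈ Z, ({x | z x ≠ x} : Set X).OrdConnected)
    (hdense : ∀ a b : X, a < b → ∃ x ∈ Ioo a b, ∃ z ∈ Z, z x ≠ x) (hf : f.Injective)
    (hcomm : ∀ z ∈ Z, ∀ x, f (z x) = z (f x)) (hfin : {x | ¬ ContinuousAt f x}.Finite)
    (hrc : ∀ x, ContinuousWithinAt f (Ici x) x) : Monotone f := by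
  intro a b hab
  by_cases h : ∃ m ∈ Icc a b, ∀ z ∈ Z, z m = m
  · obtain ⟨m, hm, hzm⟩ := h
    have hfix {x : X} (hx : ∀ z ∈ Z, z x = x) : f x = x :=
      apply_eq_self_of_forall_apply_eq hZ hord hdense hf hcomm hfin (hrc x) hx
    have hlt_iff (x : X) : f x < m ↔ x < m := by
      by_cases hx : ∀ z ∈ Z, z x = x
      · rw [hfix hx]
      · push Not at hx
        obtain ⟨z, hz, hzx⟩ := hx
        exact lt_iff_lt_of_mem_support (hord z hz) hf (hcomm z hz) hzx (hzm z hz)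
    have hb : m ≤ f b := not_lt.1 fun h => hm.2.not_gt ((hlt_iff b).1 h)
    rcases hm.1.eq_or_lt with rfl | ham
    · exact (hfix hzm).trans_le hb
    · exact ((hlt_iff a).2 ham).le.trans hb
  · push Not at h
    exact le_of_forall_mem_support hZ hord hf hcomm hfin hab h

end

/-- Let `r > 0` and let `Z` be a set of homeomorphisms of `[0,r)`
such that `z(α) ≥ α` everywhere, the support of each `z ∈ Z` is an interval, and the
union of these supports is dense in `(0,r)`.  If a bijection `f` of `[0,r)` commutes
with every `z ∈ Z`, is right-continuous at every point and has only finitely many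
points of discontinuity, then `f` is continuous. -/
theorem continuous_of_commute_family (r : ℝ) (hr : 0 < r)
    (Z : Set ((Set.Ico (0:ℝ) r) ≃ₜ (Set.Ico (0:ℝ) r)))
    (hZ1 : ∀ z ∈ Z, ∀ α : Set.Ico (0:ℝ) r, (α : ℝ) ≤ (z α : ℝ))
    (hZ2 : ∀ z ∈ Z, ({α | z α ≠ α} : Set (Set.Ico (0:ℝ) r)).OrdConnected)
    (hZ3 : Set.Ioo (0:ℝ) r ⊆ closure (⋃ z ∈ Z, Subtype.val '' {α | z α ≠ α}))
    (f : Equiv.Perm (Set.Ico (0:ℝ) r))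
    (hcomm : ∀ z ∈ Z, ∀ x, f (z x) = z (f x))
    (hrc : ∀ x, ContinuousWithinAt ⇑f (Set.Ici x) x)
    (hfin : {x | ¬ ContinuousAt ⇑f x}.Finite) :
    Continuous ⇑f := by
  have : Inhabited (Set.Ico (0:ℝ) r) := ⟨⟨0, le_rfl, hr⟩⟩
  refine Monotone.continuous_of_surjective
    (monotone_of_commute_family (Z := Z) hZ1 hZ2 ?_ f.injective hcomm hfin hrc) f.surjective
  intro a b hab
  obtain ⟨c, hac, hcb⟩ := exists_between (show (a : ℝ) < b from hab)
  obtain ⟨x, hx, hxU⟩ := mem_closure_iff.1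
    (hZ3 ⟨a.2.1.trans_lt hac, hcb.trans b.2.2⟩) (Set.Ioo a b) isOpen_Ioo ⟨hac, hcb⟩
  simp only [Set.mem_iUnion, Set.mem_image] at hxU
  obtain ⟨z, hz, y, hy, rfl⟩ := hxU
  exact ⟨y, hx, z, hz, hy⟩
end

section
/- Let α, β ∈ [0,r] ∩ A with α < β and set I = (α,β). Let x ∈ F_I be such that fix(x) ∩ I ∩ A = ∅, and let C be the centralizer of x in F_I. Then the map φ : F_I → Λ sending y to its right slope at α, y ↦ y′⁺(α), is a group homomorphism, and its restriction to C is injective. The same holds for the map y ↦ y′⁻(β) sending y to its left slope at β. -/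
open Set

/-- `L` (the `Λ` of the paper) is a subgroup of the multiplicative group of positive reals. -/
def IsSlopeSubgroup (L : Set ℝ) : Prop :=
  (∀ p ∈ L, (0:ℝ) < p) ∧ (1:ℝ) ∈ L ∧ (∀ p ∈ L, ∀ q ∈ L, p * q ∈ L) ∧ ∀ p ∈ L, p⁻¹ ∈ L

/-- `A` is an additive subgroup of `ℝ`, containing `r`, stable under multiplication
by the elements of `L`. -/
def IsSlopeModule (r : ℝ) (L A : Set ℝ) : Prop :=
  r ∈ A ∧ (0:ℝ) ∈ A ∧ (∀ a ∈ A, ∀ b ∈ A, a + b ∈ A) ∧ (∀ a ∈ A, -a ∈ A) ∧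
    ∀ p ∈ L, ∀ a ∈ A, p * a ∈ A

/-- The support of a permutation of `ℝ`. -/
def psupp (f : Equiv.Perm ℝ) : Set ℝ := {x | f x ≠ x}

/-- `f` is affine with slope `k` on the set `s`. -/
def AffOn (f : ℝ → ℝ) (s : Set ℝ) (k : ℝ) : Prop := ∃ m, ∀ x ∈ s, f x = k * x + m

/-- `f` is piecewise affine with finitely many breakpoints, all breakpoints
(necessarily lying in `[0,r]`) and their images lying in `A`, and all slopes in `L`. -/
def PiecewiseAffine (r : ℝ) (L A : Set ℝ) (f : Equiv.Perm ℝ) : Prop :=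
  ∃ B : Finset ℝ, (B : Set ℝ) ⊆ A ∩ Icc 0 r ∧ (∀ x ∈ B, f x ∈ A) ∧
    ∀ x : ℝ, x ∉ (B : Set ℝ) → ∃ ε > 0, ∃ k ∈ L, AffOn (⇑f) (Ioo (x - ε) (x + ε)) k

/-- Membership in the group `F(r,L,A)`.  We model bijections of `[0,r)` onto itself
as permutations of `ℝ` fixing the complement of `[0,r)` pointwise.  An element of
`F(r,L,A)` is such a permutation which is continuous (equivalently, its restriction
to `[0,r)` is a homeomorphism of `[0,r)` for the usual topology) and piecewise
affine with all slopes in `L` and all breakpoints, together with their images, in `A`. -/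
def memF (r : ℝ) (L A : Set ℝ) (f : Equiv.Perm ℝ) : Prop :=
  (∀ x : ℝ, x ∉ Ico (0:ℝ) r → f x = x) ∧ Continuous ⇑f ∧ PiecewiseAffine r L A f

/-- Membership in `F_S(r,L,A) = {x ∈ F(r,L,A) : supp x ⊆ S}`. -/
def memFS (r : ℝ) (L A : Set ℝ) (S : Set ℝ) (f : Equiv.Perm ℝ) : Prop :=
  memF r L A f ∧ psupp f ⊆ S

/-- `f` has right slope `k` at `a`: `f` is affine with slope `k` on an interval
immediately to the right of `a`. -/
def HasRightSlope (f : ℝ → ℝ) (a k : ℝ) : Prop := ∃ b > a, AffOn f (Ioo a b) k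

/-- `f` has left slope `k` at `b`: `f` is affine with slope `k` on an interval
immediately to the left of `b`. -/
def HasLeftSlope (f : ℝ → ℝ) (b k : ℝ) : Prop := ∃ a < b, AffOn f (Ioo a b) k

open Filter Topology

/-- Two maps commuting with an increasing permutation `x` that agree immediately to the right of
`a` agree on `(a, b)`, provided agreement propagates through the fixed points of `x`. -/
theorem eqOn_Ioo_of_comm_of_eventuallyEq_nhdsGT {X : Type*} [ConditionallyCompleteLinearOrder X]
    [TopologicalSpace X] [OrderTopology X] [DenselyOrdered X] [NoMaxOrder X]
    {x : Equiv.Perm X} {y z : X → X} {a b : X} (hab : a < b) (hx : StrictMono x) (hxa : x a = a)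
    (hxy : ∀ t, x (y t) = y (x t)) (hxz : ∀ t, x (z t) = z (x t))
    (hfix : ∀ t, a < t → t < b → x t = t → y =ᶠ[𝓝[<] t] z → y =ᶠ[𝓝 t] z)
    (h : y =ᶠ[𝓝[>] a] z) {u : X} (hau : a < u) (hub : u < b) : y u = z u := by
  have key : ∀ t, t < b → y =ᶠ[𝓝[>] t] z → ∃ t', t < t' ∧ t' ≤ b ∧ ∀ u, t < u → u < t' →
      y u = z u := by
    intro t htb ht
    obtain ⟨c, htc, hc⟩ := mem_nhdsGT_iff_exists_Ioo_subset.1 ht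
    exact ⟨min c b, lt_min htc htb, min_le_right _ _,
      fun u h1 h2 => hc ⟨h1, h2.trans_le (min_le_left _ _)⟩⟩
  let s : Set X := {t | ∀ u, a < u → y u ≠ z u → t ≤ u}
  have hs : IsClosed s := by
    have : s = ⋂ u, ⋂ (_ : a < u), ⋂ (_ : y u ≠ z u), Iic u := by
      ext t
      simp [s]
    rw [this]
    exact isClosed_iInter fun u => isClosed_iInter fun _ => isClosed_iInter fun _ => isClosed_Iic
  have hsub : Icc a b ⊆ s := by
    refine IsClosed.Icc_subset_of_forall_exists_gt (hs.inter isClosed_Icc)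
      (fun u hu _ => hu.le) ?_
    rintro t ⟨hts, hat, htb⟩ c htc
    suffices ∃ t', t < t' ∧ t' ∈ s by
      obtain ⟨t', htt', ht'⟩ := this
      exact ⟨min t' c, fun u h1 h2 => (min_le_left _ _).trans (ht' u h1 h2),
        lt_min htt' htc, min_le_right _ _⟩
    have hlt : ∀ u, a < u → u < t → y u = z u := fun u h1 h2 => by
      by_contra h3
      exact absurd (hts u h1 h3) (not_le.2 h2)
    rcases hat.eq_or_lt with rfl | hat
    · obtain ⟨t', htt', -, ht'⟩ := key a htb h
      exact ⟨t', htt', fun u h1 h2 => not_lt.1 fun h3 => h2 (ht' u h1 h3)⟩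
    rcases lt_trichotomy (x t) t with hxt | hxt | hxt
    · refine ⟨x.symm t, hx.lt_iff_lt.1 (by simpa using hxt), fun u h1 h2 => ?_⟩
      by_contra! h3
      refine h2 (x.injective ?_)
      rw [hxy, hxz]
      exact hlt _ (hxa ▸ hx h1) (by simpa using hx h3)
    · have hn := hfix t hat htb hxt (by
        filter_upwards [Ioo_mem_nhdsLT hat] with u hu using hlt u hu.1 hu.2)
      obtain ⟨t', htt', -, ht'⟩ := key t htb (hn.filter_mono nhdsWithin_le_nhds)
      refine ⟨t', htt', fun u h1 h2 => not_lt.1 fun h3 => h2 ?_⟩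
      rcases lt_trichotomy u t with hut | rfl | hut
      · exact hlt u h1 hut
      · exact hn.self_of_nhds
      · exact ht' u hut h3
    · refine ⟨x t, hxt, fun u h1 h2 => ?_⟩
      by_contra! h3
      refine h2 ?_
      have := hlt (x.symm u) (hx.lt_iff_lt.1 (by simpa [hxa] using h1))
        (hx.lt_iff_lt.1 (by simpa using h3))
      have := congrArg x this
      rwa [hxy, hxz, x.apply_symm_apply] at this
  by_contra hne
  exact absurd (hsub (right_mem_Icc.2 hab.le) u hau hne) (not_le.2 hub)

theorem hasRightSlope_iff_eventuallyEq {f : ℝ → ℝ} {a k : ℝ} :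
    HasRightSlope f a k ↔ ∃ m, f =ᶠ[𝓝[>] a] fun u => k * u + m := by
  constructor
  · rintro ⟨b, hb, m, hm⟩
    exact ⟨m, eventually_of_mem (Ioo_mem_nhdsGT hb) hm⟩
  · rintro ⟨m, hm⟩
    obtain ⟨b, hb, h⟩ := mem_nhdsGT_iff_exists_Ioo_subset.1 hm
    exact ⟨b, hb, m, h⟩

theorem hasLeftSlope_iff_eventuallyEq {f : ℝ → ℝ} {b k : ℝ} :
    HasLeftSlope f b k ↔ ∃ m, f =ᶠ[𝓝[<] b] fun u => k * u + m := by
  constructor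
  · rintro ⟨a, ha, m, hm⟩
    exact ⟨m, eventually_of_mem (Ioo_mem_nhdsLT ha) hm⟩
  · rintro ⟨m, hm⟩
    obtain ⟨a, ha, h⟩ := mem_nhdsLT_iff_exists_Ioo_subset.1 hm
    exact ⟨a, ha, m, h⟩

/-- Two maps that are affine near `t` and agree along a filter punctured at `t` agree near `t`. -/
theorem eventuallyEq_nhds_of_affine {f g : ℝ → ℝ} {t k m k' m' : ℝ} {l : Filter ℝ} [l.NeBot]
    (hl : l ≤ 𝓝[≠] t) (hf : f =ᶠ[𝓝 t] fun u => k * u + m) (hg : g =ᶠ[𝓝 t] fun u => k' * u + m')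
    (h : f =ᶠ[l] g) : f =ᶠ[𝓝 t] g := by
  have hlt : l ≤ 𝓝 t := hl.trans nhdsWithin_le_nhds
  have hc : ∀ k m : ℝ, Tendsto (fun u => k * u + m) l (𝓝 (k * t + m)) := fun k m =>
    (Continuous.tendsto (by fun_prop) t).mono_left hlt
  have haff : (fun u => k * u + m) =ᶠ[l] fun u => k' * u + m' :=
    (hf.filter_mono hlt).symm.trans (h.trans (hg.filter_mono hlt))
  have ht : k * t + m = k' * t + m' := tendsto_nhds_unique_of_eventuallyEq (hc k m) (hc k' m') haff
  obtain ⟨u, hu, hut⟩ := (haff.and (hl self_mem_nhdsWithin)).exists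
  have hk : k = k' := by
    have : (k - k') * (u - t) = 0 := by linear_combination hu - ht
    rcases mul_eq_zero.1 this with h0 | h0
    · linarith
    · exact absurd (sub_eq_zero.1 h0) hut
  subst hk
  have hm : m = m' := by linarith
  subst hm
  exact hf.trans hg.symm

/-- A map that is locally affine on an open interval, with slopes in `L`, is affine there. -/
theorem exists_affOn_Ioo {L : Set ℝ} {f : ℝ → ℝ} {a b : ℝ} (hab : a < b)
    (h : ∀ t ∈ Ioo a b, ∃ k ∈ L, ∃ m, f =ᶠ[𝓝 t] fun u => k * u + m) :
    ∃ k ∈ L, AffOn f (Ioo a b) k := by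
  obtain ⟨p, hp⟩ := nonempty_Ioo.2 hab
  obtain ⟨k, hk, m, hm⟩ := h p hp
  have haff : ∀ k m t : ℝ, AnalyticAt ℝ (fun u => k * u + m) t := fun k m t => by fun_prop
  have hf : AnalyticOnNhd ℝ f (Ioo a b) := fun t ht => by
    obtain ⟨k', -, m', h'⟩ := h t ht
    exact (haff k' m' t).congr h'.symm
  exact ⟨k, hk, m, hf.eqOn_of_preconnected_of_eventuallyEq (fun t _ => haff k m t)
    isPreconnected_Ioo hp hm⟩

/-- Maps with equal one-sided slopes and equal values at `a` agree on that side near `a`. -/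
theorem eventuallyEq_of_affine_of_tendsto {f g : ℝ → ℝ} {a c k m m' : ℝ} {l : Filter ℝ} [l.NeBot]
    (hl : l ≤ 𝓝 a) (hf : Tendsto f l (𝓝 c)) (hg : Tendsto g l (𝓝 c))
    (hfk : f =ᶠ[l] fun u => k * u + m) (hgk : g =ᶠ[l] fun u => k * u + m') : f =ᶠ[l] g := by
  have hc : ∀ m : ℝ, Tendsto (fun u => k * u + m) l (𝓝 (k * a + m)) := fun m =>
    (Continuous.tendsto (by fun_prop) a).mono_left hl
  have h1 := tendsto_nhds_unique_of_eventuallyEq hf (hc m) hfk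
  have h2 := tendsto_nhds_unique_of_eventuallyEq hg (hc m') hgk
  have hm : m = m' := by linarith
  subst hm
  exact hfk.trans hgk.symm

theorem eventuallyEq_comp_affine {f g : ℝ → ℝ} {k m k' m' : ℝ} {l : Filter ℝ}
    (hg : Tendsto g l l) (hfk : f =ᶠ[l] fun u => k * u + m) (hgk : g =ᶠ[l] fun u => k' * u + m') :
    f ∘ g =ᶠ[l] fun u => k * k' * u + (k * m' + m) := by
  filter_upwards [hg.eventually hfk, hgk] with u h1 h2
  rw [Function.comp_apply, h1, h2]
  ring

namespace memF

variable {r : ℝ} {L A : Set ℝ} {f : Equiv.Perm ℝ}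

protected theorem continuous (hf : memF r L A f) : Continuous f := hf.2.1

theorem strictMono (hf : memF r L A f) : StrictMono f := by
  refine (hf.continuous.strictMono_of_inj f.injective).resolve_right fun h => ?_
  have h1 : f (-1) = -1 := hf.1 _ (by simp)
  have h2 : f (-2) = -2 := hf.1 _ (by simp)
  have := h (show (-2 : ℝ) < -1 by norm_num)
  rw [h1, h2] at this
  norm_num at this

theorem exists_finset (hf : memF r L A f) : ∃ B : Finset ℝ, (B : Set ℝ) ⊆ A ∧
    ∀ t ∉ B, ∃ k ∈ L, ∃ m, f =ᶠ[𝓝 t] fun u => k * u + m := by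
  obtain ⟨B, hB, -, h⟩ := hf.2.2
  refine ⟨B, fun t ht => (hB ht).1, fun t ht => ?_⟩
  obtain ⟨ε, hε, k, hk, m, hm⟩ := h t (by simpa using ht)
  exact ⟨k, hk, m, eventually_of_mem (Ioo_mem_nhds (by linarith) (by linarith)) hm⟩

theorem exists_eventuallyEq_affine (hf : memF r L A f) {t : ℝ} (ht : t ∉ A) :
    ∃ k m, f =ᶠ[𝓝 t] fun u => k * u + m := by
  obtain ⟨B, hB, h⟩ := hf.exists_finset
  obtain ⟨k, -, m, hm⟩ := h t fun h => ht (hB h)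
  exact ⟨k, m, hm⟩

theorem exists_hasRightSlope (hf : memF r L A f) (a : ℝ) : ∃ k ∈ L, HasRightSlope f a k := by
  obtain ⟨B, -, h⟩ := hf.exists_finset
  have hB : ((B : Set ℝ) \ {a})ᶜ ∈ 𝓝[>] a := nhdsWithin_le_nhds <|
    (B.finite_toSet.subset sdiff_subset).isClosed.isOpen_compl.mem_nhds (by simp)
  obtain ⟨b, hab, hb⟩ := mem_nhdsGT_iff_exists_Ioo_subset.1 hB
  obtain ⟨k, hk, hk'⟩ := exists_affOn_Ioo hab fun t ht =>
    h t fun htB => hb ht ⟨htB, ht.1.ne'⟩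
  exact ⟨k, hk, b, hab, hk'⟩

theorem exists_hasLeftSlope (hf : memF r L A f) (b : ℝ) : ∃ k ∈ L, HasLeftSlope f b k := by
  obtain ⟨B, -, h⟩ := hf.exists_finset
  have hB : ((B : Set ℝ) \ {b})ᶜ ∈ 𝓝[<] b := nhdsWithin_le_nhds <|
    (B.finite_toSet.subset sdiff_subset).isClosed.isOpen_compl.mem_nhds (by simp)
  obtain ⟨a, hab, ha⟩ := mem_nhdsLT_iff_exists_Ioo_subset.1 hB
  obtain ⟨k, hk, hk'⟩ := exists_affOn_Ioo hab fun t ht =>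
    h t fun htB => ha ht ⟨htB, ht.2.ne⟩
  exact ⟨k, hk, a, hab, hk'⟩

theorem tendsto_nhdsGT (hf : memF r L A f) {a : ℝ} (ha : f a = a) :
    Tendsto f (𝓝[>] a) (𝓝[>] a) := by
  refine tendsto_nhdsWithin_iff.2 ⟨?_, ?_⟩
  · simpa [ha] using (hf.continuous.tendsto a).mono_left nhdsWithin_le_nhds
  · filter_upwards [self_mem_nhdsWithin] with u hu
    simpa [ha] using hf.strictMono hu

theorem tendsto_nhdsLT (hf : memF r L A f) {a : ℝ} (ha : f a = a) :
    Tendsto f (𝓝[<] a) (𝓝[<] a) := by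
  refine tendsto_nhdsWithin_iff.2 ⟨?_, ?_⟩
  · simpa [ha] using (hf.continuous.tendsto a).mono_left nhdsWithin_le_nhds
  · filter_upwards [self_mem_nhdsWithin] with u hu
    simpa [ha] using hf.strictMono hu

end memF

theorem memFS.apply_eq_self {r : ℝ} {L A S : Set ℝ} {f : Equiv.Perm ℝ} (hf : memFS r L A S f)
    {t : ℝ} (ht : t ∉ S) : f t = t := by
  by_contra h
  exact ht (hf.2 h)

/-- Let `α, β ∈ [0,r] ∩ A` with `α < β`, `I = (α,β)`, and let
`x ∈ F_I` have no fixed point in `I ∩ A`.  Then the map `φ : F_I → Λ`, `y ↦ y′⁺(α)`,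
is a group homomorphism whose restriction to the centralizer `C` of `x` in `F_I` is
injective; and similarly for `y ↦ y′⁻(β)`. -/
theorem rightSlope_hom_injOn_centralizer (r : ℝ) (L A : Set ℝ) (hr : 0 < r)
    (hL : IsSlopeSubgroup L) (hLne : L ≠ {1}) (hA : IsSlopeModule r L A)
    (α β : ℝ) (hα : α ∈ Icc 0 r ∩ A) (hβ : β ∈ Icc 0 r ∩ A) (hαβ : α < β)
    (x : Equiv.Perm ℝ) (hx : memFS r L A (Ioo α β) x)
    (hxfix : {γ | x γ = γ} ∩ Ioo α β ∩ A = ∅) :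
    ((∀ y : Equiv.Perm ℝ, memFS r L A (Ioo α β) y →
        ∃ k ∈ L, HasRightSlope (⇑y) α k) ∧
      (∀ y z : Equiv.Perm ℝ, ∀ ky kz : ℝ,
        memFS r L A (Ioo α β) y → memFS r L A (Ioo α β) z →
        HasRightSlope (⇑y) α ky → HasRightSlope (⇑z) α kz →
        HasRightSlope (⇑(y * z)) α (ky * kz)) ∧
      (∀ y z : Equiv.Perm ℝ, ∀ k : ℝ,
        memFS r L A (Ioo α β) y → Commute x y →
        memFS r L A (Ioo α β) z → Commute x z →
        HasRightSlope (⇑y) α k → HasRightSlope (⇑z) α k → y = z)) ∧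
    ((∀ y : Equiv.Perm ℝ, memFS r L A (Ioo α β) y →
        ∃ k ∈ L, HasLeftSlope (⇑y) β k) ∧
      (∀ y z : Equiv.Perm ℝ, ∀ ky kz : ℝ,
        memFS r L A (Ioo α β) y → memFS r L A (Ioo α β) z →
        HasLeftSlope (⇑y) β ky → HasLeftSlope (⇑z) β kz →
        HasLeftSlope (⇑(y * z)) β (ky * kz)) ∧
      (∀ y z : Equiv.Perm ℝ, ∀ k : ℝ,
        memFS r L A (Ioo α β) y → Commute x y →
        memFS r L A (Ioo α β) z → Commute x z →
        HasLeftSlope (⇑y) β k → HasLeftSlope (⇑z) β k → y = z)) := by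
  have hcomm : ∀ y : Equiv.Perm ℝ, Commute x y → ∀ t, x (y t) = y (x t) :=
    fun y h t => DFunLike.congr_fun h.eq t
  have hA' : ∀ t, α < t → t < β → x t = t → t ∉ A := fun t h1 h2 h3 h4 =>
    hxfix.subset ⟨⟨h3, h1, h2⟩, h4⟩
  have hext : ∀ y z : Equiv.Perm ℝ, memFS r L A (Ioo α β) y → memFS r L A (Ioo α β) z →
      (∀ t, α < t → t < β → y t = z t) → y = z := fun y z hy hz h => by
    ext t
    by_cases ht : t ∈ Ioo α β
    · exact h t ht.1 ht.2
    · rw [hy.apply_eq_self ht, hz.apply_eq_self ht]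
  have hpass : ∀ y z : Equiv.Perm ℝ, memFS r L A (Ioo α β) y → memFS r L A (Ioo α β) z →
      ∀ l : Filter ℝ, l.NeBot → ∀ t, α < t → t < β → x t = t → l ≤ 𝓝[≠] t → y =ᶠ[l] z →
        y =ᶠ[𝓝 t] z := fun y z hy hz l _ t h1 h2 h3 hl h => by
    obtain ⟨k, m, hk⟩ := hy.1.exists_eventuallyEq_affine (hA' t h1 h2 h3)
    obtain ⟨k', m', hk'⟩ := hz.1.exists_eventuallyEq_affine (hA' t h1 h2 h3)
    exact eventuallyEq_nhds_of_affine hl hk hk' h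
  have hα' : α ∉ Ioo α β := left_notMem_Ioo
  have hβ' : β ∉ Ioo α β := right_notMem_Ioo
  simp only [hasRightSlope_iff_eventuallyEq, hasLeftSlope_iff_eventuallyEq, Equiv.Perm.coe_mul]
  refine ⟨⟨fun y hy => ?_, ?_, ?_⟩, ⟨fun y hy => ?_, ?_, ?_⟩⟩
  · simpa only [hasRightSlope_iff_eventuallyEq] using hy.1.exists_hasRightSlope α
  · rintro y z ky kz - hz ⟨m, hm⟩ ⟨m', hm'⟩
    exact ⟨_, eventuallyEq_comp_affine (hz.1.tendsto_nhdsGT (hz.apply_eq_self hα')) hm hm'⟩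
  · rintro y z k hy hxy hz hxz ⟨m, hm⟩ ⟨m', hm'⟩
    have h0 := eventuallyEq_of_affine_of_tendsto nhdsWithin_le_nhds
      ((hy.1.tendsto_nhdsGT (hy.apply_eq_self hα')).mono_right nhdsWithin_le_nhds)
      ((hz.1.tendsto_nhdsGT (hz.apply_eq_self hα')).mono_right nhdsWithin_le_nhds) hm hm'
    exact hext y z hy hz fun t h1 h2 => eqOn_Ioo_of_comm_of_eventuallyEq_nhdsGT hαβ
      hx.1.strictMono (hx.apply_eq_self hα') (hcomm y hxy) (hcomm z hxz)
      (fun t h1 h2 h3 => hpass y z hy hz _ inferInstance t h1 h2 h3 (nhdsLT_le_nhdsNE t))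
      h0 h1 h2
  · simpa only [hasLeftSlope_iff_eventuallyEq] using hy.1.exists_hasLeftSlope β
  · rintro y z ky kz - hz ⟨m, hm⟩ ⟨m', hm'⟩
    exact ⟨_, eventuallyEq_comp_affine (hz.1.tendsto_nhdsLT (hz.apply_eq_self hβ')) hm hm'⟩
  · rintro y z k hy hxy hz hxz ⟨m, hm⟩ ⟨m', hm'⟩
    have h0 := eventuallyEq_of_affine_of_tendsto nhdsWithin_le_nhds
      ((hy.1.tendsto_nhdsLT (hy.apply_eq_self hβ')).mono_right nhdsWithin_le_nhds)
      ((hz.1.tendsto_nhdsLT (hz.apply_eq_self hβ')).mono_right nhdsWithin_le_nhds) hm hm'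
    exact hext y z hy hz fun t h1 h2 => eqOn_Ioo_of_comm_of_eventuallyEq_nhdsGT (X := ℝᵒᵈ)
      (x := x) (a := β) (b := α) hαβ
      hx.1.strictMono.dual (hx.apply_eq_self hβ') (hcomm y hxy) (hcomm z hxz)
      (fun (t : ℝ) h1 h2 h3 =>
        hpass y z hy hz (𝓝[>] t) inferInstance t h2 h1 h3 (nhdsGT_le_nhdsNE t))
      h0 h2 h1
end

section
/- Let α, β ∈ [0,r] ∩ A with α < β, and let p, q ∈ Λ with p > 1 > q. Then there exists x ∈ F↑ such that supp(x) = (α,β), x′⁺(α) = p, and x′⁻(β) = q. -/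
open Set

theorem AffOn.exists_ball {f : ℝ → ℝ} {u v k : ℝ} (h : AffOn f (Ioo u v) k) {x : ℝ}
    (hx : x ∈ Ioo u v) : ∃ ε > 0, AffOn f (Ioo (x - ε) (x + ε)) k := by
  obtain ⟨m, hm⟩ := h
  refine ⟨min (x - u) (v - x), lt_min (sub_pos.2 hx.1) (sub_pos.2 hx.2), m, fun y hy => ?_⟩
  have h1 := min_le_left (x - u) (v - x)
  have h2 := min_le_right (x - u) (v - x)
  exact hm y ⟨by linarith [hy.1], by linarith [hy.2]⟩

theorem IsSlopeModule.exists_mem_pos_mul_lt {r : ℝ} {L A : Set ℝ} (hL : IsSlopeSubgroup L)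
    (hA : IsSlopeModule r L A) {q : ℝ} (hq : q ∈ L) (hq1 : q < 1) {l : ℝ} (hl : l ∈ A)
    (hl0 : 0 < l) (s : ℝ) (hs : 0 < s) : ∃ c ∈ A, 0 < c ∧ s * c < l := by
  have hq0 := hL.1 q hq
  obtain ⟨n, hn⟩ := exists_pow_lt_of_lt_one (inv_pos.2 hs) hq1
  refine ⟨q ^ n * l, ?_, by positivity, ?_⟩
  · clear hn
    induction n with
    | zero => simpa using hl
    | succ n ih =>
      rw [pow_succ', mul_assoc]
      exact hA.2.2.2.2 q hq _ ih
  · have : s * q ^ n < 1 := by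
      calc s * q ^ n < s * s⁻¹ := by gcongr
        _ = 1 := mul_inv_cancel₀ hs.ne'
    nlinarith

/-- The identity outside `[α, β]`; on `[α, β]`, the minimum of the affine maps of slope `p`
fixing `α`, of slope `q` fixing `β`, and the translation by `t`. -/
noncomputable def bump (α β p q t : ℝ) (x : ℝ) : ℝ :=
  max x (min (min (α + p * (x - α)) (β + q * (x - β))) (x + t))

section bump

variable {α β p q t x : ℝ}

theorem continuous_bump : Continuous (bump α β p q t) := by
  unfold bump
  fun_prop

theorem le_bump : x ≤ bump α β p q t x := le_max_left _ _

theorem strictMono_bump (hp : 0 < p) (hq : 0 < q) : StrictMono (bump α β p q t) := by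
  intro x y h
  have h1 : p * (x - α) < p * (y - α) := by gcongr
  have h2 : q * (x - β) < q * (y - β) := by gcongr
  exact max_lt_max h (min_lt_min (min_lt_min (by linarith) (by linarith)) (by linarith))

theorem surjective_bump (ht : 0 ≤ t) : Function.Surjective (bump α β p q t) := by
  refine continuous_bump.surjective
    (Filter.tendsto_atTop_mono (fun x => le_bump) Filter.tendsto_id)
    (Filter.tendsto_atBot_mono (fun x => ?_) (Filter.tendsto_atBot_add_const_right _ t
      Filter.tendsto_id))
  exact max_le (by simpa using ht) (min_le_right _ _)

theorem bump_of_le_left (hp : 1 < p) (h : x ≤ α) : bump α β p q t x = x :=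
  max_eq_left ((min_le_left _ _).trans ((min_le_left _ _).trans (by nlinarith)))

theorem bump_of_right_le (hq : q < 1) (h : β ≤ x) : bump α β p q t x = x :=
  max_eq_left ((min_le_left _ _).trans ((min_le_right _ _).trans (by nlinarith)))

theorem lt_bump (hp : 1 < p) (hq : q < 1) (ht : 0 < t) (h : x ∈ Ioo α β) :
    x < bump α β p q t x := by
  refine lt_max_of_lt_right (lt_min (lt_min ?_ ?_) (by linarith))
  · nlinarith [mul_pos (sub_pos.2 hp) (sub_pos.2 h.1)]
  · nlinarith [mul_pos (sub_pos.2 hq) (sub_pos.2 h.2)]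

theorem bump_of_near_left (hp : 1 < p) (h0 : α ≤ x) (h1 : (p - 1) * (x - α) ≤ t)
    (h2 : t ≤ (1 - q) * (β - x)) : bump α β p q t x = α + p * (x - α) := by
  unfold bump
  rw [min_eq_left (a := α + p * (x - α)) (by linarith), min_eq_left (by linarith),
    max_eq_right (by nlinarith)]

theorem bump_of_mid (ht : 0 ≤ t) (h1 : t ≤ (p - 1) * (x - α))
    (h2 : t ≤ (1 - q) * (β - x)) : bump α β p q t x = x + t := by
  unfold bump
  rw [min_eq_right (le_min (by linarith) (by linarith)), max_eq_right (by linarith)]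

theorem bump_of_near_right (hq : q < 1) (h0 : x ≤ β) (h1 : t ≤ (p - 1) * (x - α))
    (h2 : (1 - q) * (β - x) ≤ t) : bump α β p q t x = β + q * (x - β) := by
  unfold bump
  rw [min_eq_right (a := α + p * (x - α)) (by linarith), min_eq_left (by linarith),
    max_eq_right (by nlinarith)]

end bump

/-- Let `α, β ∈ [0,r] ∩ A` with `α < β` and let `p, q ∈ Λ` with
`p > 1 > q`.  Then there is `x ∈ F↑` with `supp x = (α,β)`, `x′⁺(α) = p`
and `x′⁻(β) = q`. -/
theorem exists_Fup_supp_Ioo_slopes (r : ℝ) (L A : Set ℝ) (hr : 0 < r)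
    (hL : IsSlopeSubgroup L) (hLne : L ≠ {1}) (hA : IsSlopeModule r L A)
    (α β : ℝ) (hα : α ∈ Icc 0 r ∩ A) (hβ : β ∈ Icc 0 r ∩ A) (hαβ : α < β)
    (p q : ℝ) (hp : p ∈ L) (hq : q ∈ L) (hp1 : 1 < p) (hq1 : q < 1) :
    ∃ x : Equiv.Perm ℝ, memF r L A x ∧ (∀ γ ∈ Ico (0:ℝ) r, γ ≤ x γ) ∧
      psupp x = Ioo α β ∧ HasRightSlope (⇑x) α p ∧ HasLeftSlope (⇑x) β q := by
  obtain ⟨⟨hα0, hαr⟩, hαA⟩ := hα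
  obtain ⟨⟨hβ0, hβr⟩, hβA⟩ := hβ
  have hadd := hA.2.2.1
  have hmul := hA.2.2.2.2
  have hsub : ∀ a ∈ A, ∀ b ∈ A, a - b ∈ A := fun a ha b hb => by
    rw [sub_eq_add_neg]
    exact hadd a ha _ (hA.2.2.2.1 b hb)
  obtain ⟨c, hcA, hc0, hc⟩ := hA.exists_mem_pos_mul_lt hL hq hq1 (hsub β hβA α hαA)
    (sub_pos.2 hαβ) (p - q) (by linarith)
  have hp0 := hL.1 p hp
  have hq0 := hL.1 q hq
  have hp' := sub_pos.2 hp1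
  have hq' := sub_pos.2 hq1
  -- the middle piece is translation by `t`, on `[u, v]`
  obtain ⟨u, hu⟩ : ∃ u, u = α + (c - q * c) := ⟨_, rfl⟩
  obtain ⟨v, hv⟩ : ∃ v, v = β - (p * c - c) := ⟨_, rfl⟩
  obtain ⟨t, ht⟩ : ∃ t, t = (p - 1) * (1 - q) * c := ⟨_, rfl⟩
  have ht0 : 0 < t := by rw [ht]; positivity
  have htu : t = (p - 1) * (u - α) := by rw [ht, hu]; ring
  have htv : t = (1 - q) * (β - v) := by rw [ht, hv]; ring
  have hαu : α < u := by nlinarith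
  have huv : u < v := by nlinarith
  have hvβ : v < β := by nlinarith
  have huA : u ∈ A := hu ▸ hadd _ hαA _ (hsub _ hcA _ (hmul q hq c hcA))
  have hvA : v ∈ A := hv ▸ hsub _ hβA _ (hsub _ (hmul p hp c hcA) _ hcA)
  have p_mono : ∀ {x y : ℝ}, x ≤ y → (p - 1) * (x - α) ≤ (p - 1) * (y - α) :=
    fun h => by gcongr
  have q_anti : ∀ {x y : ℝ}, x ≤ y → (1 - q) * (β - y) ≤ (1 - q) * (β - x) :=
    fun h => by gcongr
  set f := bump α β p q t
  have near_left : ∀ x, α ≤ x → x ≤ u → f x = α + p * (x - α) := fun x h1 h2 =>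
    bump_of_near_left hp1 h1 (htu ▸ p_mono h2) (htv.le.trans (q_anti (h2.trans huv.le)))
  have mid : ∀ x, u ≤ x → x ≤ v → f x = x + t := fun x h1 h2 =>
    bump_of_mid ht0.le (htu.le.trans (p_mono h1)) (htv.le.trans (q_anti h2))
  have near_right : ∀ x, v ≤ x → x ≤ β → f x = β + q * (x - β) := fun x h1 h2 =>
    bump_of_near_right hq1 h2 (htu.le.trans (p_mono (huv.le.trans h1)))
      ((q_anti h1).trans htv.ge)
  have aff_left : AffOn f (Ioo α u) p := ⟨α - p * α, fun x hx => by
    rw [near_left x hx.1.le hx.2.le]; ring⟩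
  have aff_right : AffOn f (Ioo v β) q := ⟨β - q * β, fun x hx => by
    rw [near_right x hx.1.le hx.2.le]; ring⟩
  have fix_left : ∀ x ≤ α, f x = x := fun x h => bump_of_le_left hp1 h
  have fix_right : ∀ x, β ≤ x → f x = x := fun x h => bump_of_right_le hq1 h
  refine ⟨Equiv.ofBijective f ⟨(strictMono_bump hp0 hq0).injective, surjective_bump ht0.le⟩,
    ⟨fun x hx => ?_, continuous_bump, {α, u, v, β}, ?_, ?_, fun x hx => ?_⟩,
    fun x _ => le_bump, ?_, ⟨u, hαu, aff_left⟩, ⟨v, hvβ, aff_right⟩⟩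
  · rcases lt_or_ge x 0 with h | h
    · exact fix_left x (h.le.trans hα0)
    · exact fix_right x (hβr.trans (not_lt.1 fun h' => hx ⟨h, h'⟩))
  · intro x hx
    simp only [Finset.coe_insert, Finset.coe_singleton, mem_insert_iff, mem_singleton_iff] at hx
    rcases hx with rfl | rfl | rfl | rfl
    · exact ⟨hαA, hα0, hαr⟩
    · exact ⟨huA, by linarith, by linarith⟩
    · exact ⟨hvA, by linarith, by linarith⟩
    · exact ⟨hβA, hβ0, hβr⟩
  · intro x hx
    simp only [Finset.mem_insert, Finset.mem_singleton] at hx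
    change f x ∈ A
    rcases hx with hx | hx | hx | hx <;> rw [hx]
    · rwa [fix_left α le_rfl]
    · rw [near_left u hαu.le le_rfl]
      exact hadd _ hαA _ (hmul p hp _ (hsub _ huA _ hαA))
    · rw [near_right v le_rfl hvβ.le]
      exact hadd _ hβA _ (hmul q hq _ (hsub _ hvA _ hβA))
    · rwa [fix_right β le_rfl]
  · suffices h : ∃ k ∈ L, ∃ a b, x ∈ Ioo a b ∧ AffOn f (Ioo a b) k by
      obtain ⟨k, hk, a, b, hab, h⟩ := h
      obtain ⟨ε, hε, h⟩ := h.exists_ball hab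
      exact ⟨ε, hε, k, hk, h⟩
    simp only [Finset.coe_insert, Finset.coe_singleton, mem_insert_iff, mem_singleton_iff,
      not_or] at hx
    obtain ⟨h1, h2, h3, h4⟩ := hx
    rcases lt_or_gt_of_ne h1 with h1 | h1
    · exact ⟨1, hL.2.1, x - 1, α, ⟨by linarith, h1⟩, 0, fun y hy => by
        rw [fix_left y hy.2.le]; ring⟩
    rcases lt_or_gt_of_ne h2 with h2 | h2
    · exact ⟨p, hp, α, u, ⟨h1, h2⟩, aff_left⟩
    rcases lt_or_gt_of_ne h3 with h3 | h3
    · exact ⟨1, hL.2.1, u, v, ⟨h2, h3⟩, t, fun y hy => by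
        rw [mid y hy.1.le hy.2.le]; ring⟩
    rcases lt_or_gt_of_ne h4 with h4 | h4
    · exact ⟨q, hq, v, β, ⟨h3, h4⟩, aff_right⟩
    · exact ⟨1, hL.2.1, β, x + 1, ⟨h4, by linarith⟩, 0, fun y hy => by
        rw [fix_right y hy.1.le]; ring⟩
  · ext x
    refine ⟨fun hx => ⟨?_, ?_⟩, fun hx => (lt_bump hp1 hq1 ht0 hx).ne'⟩
    · exact not_le.1 fun h => hx (fix_left x h)
    · exact not_le.1 fun h => hx (fix_right x h)
end

section
/- Let a ∈ F↑ with supp(a) = (0,r), let α₀ ∈ (0,r) ∩ A, set αₖ = aᵏ(α₀) for k ∈ ℤ, and let b ∈ F↑ with supp(b) = (α₀,α₁). Write bₖ = a⁻ᵏ b aᵏ for k ∈ ℤ. Then: (i) supp(bₖ) = (αₖ, αₖ₊₁) for every k ∈ ℤ, so these supports are pairwise disjoint; (ii) the subgroup N = ⟨bₖ : k ∈ ℤ⟩ is free abelian with basis (bₖ)_{k∈ℤ}, i.e. N is the internal direct sum of the infinite cyclic subgroups ⟨bₖ⟩; (iii) N ∩ ⟨a⟩ = {1} and ⟨a⟩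 is infinite cyclic; (iv) conjugation by a sends bₖ to bₖ₊₁, N is normal in ⟨a,b⟩, and ⟨a,b⟩ = N ⋊ ⟨a⟩. In particular ⟨a,b⟩ is isomorphic to the restricted wreath product ℤ ≀ ℤ = (⨁_{k∈ℤ} ℤ) ⋊ ℤ, where ℤ acts by shifting the coordinates. -/
open Set

/-- The shift `e_k ↦ e_{k+n}` on the free abelian group `⨁_{k∈ℤ} ℤ` (= `ℤ →₀ ℤ`). -/
noncomputable def shiftAut (n : ℤ) : (ℤ →₀ ℤ) ≃+ (ℤ →₀ ℤ) :=
  Finsupp.domCongr (Equiv.addRight n)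

/-- The action of `ℤ` on `⨁_{k∈ℤ} ℤ` by shifting the coordinates. -/
noncomputable def shiftHom :
    Multiplicative ℤ →* MulAut (Multiplicative (ℤ →₀ ℤ)) :=
  MonoidHom.mk' (fun n => AddEquiv.toMultiplicative (shiftAut n.toAdd))
    (by
      intro m n
      refine MulEquiv.ext fun x => ?_
      show Multiplicative.ofAdd (shiftAut (m.toAdd + n.toAdd) x.toAdd) =
        Multiplicative.ofAdd (shiftAut m.toAdd (shiftAut n.toAdd x.toAdd))
      congr 1
      ext k
      simp [shiftAut, Finsupp.domCongr_apply, Finsupp.equivMapDomain_apply, sub_sub,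
        add_comm, Equiv.Perm.mul_def, Equiv.symm_trans_apply]
      congr 1
      ring)

/-- The restricted wreath product `ℤ ≀ ℤ = (⨁_{k∈ℤ} ℤ) ⋊ ℤ`, with `ℤ` acting by
shifting the coordinates. -/
abbrev ZwrZ : Type :=
  SemidirectProduct (Multiplicative (ℤ →₀ ℤ)) (Multiplicative ℤ) shiftHom

/-- The element `a = (0, 1)` of `ℤ ≀ ℤ`. -/
noncomputable def wa : ZwrZ := SemidirectProduct.inr (Multiplicative.ofAdd (1 : ℤ))

/-- The element `b = (e₀, 0)` of `ℤ ≀ ℤ`. -/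
noncomputable def wb : ZwrZ :=
  SemidirectProduct.inl (Multiplicative.ofAdd (Finsupp.single (0 : ℤ) (1 : ℤ)))

/-- The base subgroup `H × {0}` of `ℤ ≀ ℤ`, where `H = ⨁_{k∈ℤ} ℤ`. -/
noncomputable def baseH : Subgroup ZwrZ :=
  (SemidirectProduct.inl : Multiplicative (ℤ →₀ ℤ) →* ZwrZ).range

/-- A pairwise commuting family in a group extends to a homomorphism from the free abelian
group on the index set. -/
theorem exists_hom_of_pairwise_commute {ι G : Type*} [Group G] (b : ι → G)
    (hb : ∀ i j, b i * b j = b j * b i) :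
    ∃ Φ : Multiplicative (ι →₀ ℤ) →* G,
      ∀ i, Φ (Multiplicative.ofAdd (Finsupp.single i 1)) = b i := by
  have : IsMulCommutative (Subgroup.closure (Set.range b)) :=
    Subgroup.isMulCommutative_closure (by
      rintro _ ⟨i, rfl⟩ _ ⟨j, rfl⟩
      exact hb i j)
  let : CommGroup (Subgroup.closure (Set.range b)) :=
    { (Subgroup.closure (Set.range b)).toGroup with mul_comm := mul_comm' }
  let c : ι → Subgroup.closure (Set.range b) :=
    fun i => ⟨b i, Subgroup.subset_closure (Set.mem_range_self i)⟩
  let T : (ι →₀ ℤ) →+ Additive (Subgroup.closure (Set.range b)) :=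
    Finsupp.liftAddHom fun i => zmultiplesHom _ (Additive.ofMul (c i))
  refine ⟨(Subgroup.closure (Set.range b)).subtype.comp (AddMonoidHom.toMultiplicativeLeft T),
    fun i => ?_⟩
  have h : T (Finsupp.single i 1) = Additive.ofMul (c i) := by simp [T]
  change ((T (Finsupp.single i 1)).toMul : G) = b i
  rw [h]
  rfl

/-- Induction principle for the free abelian group, written multiplicatively. -/
theorem freeAbelian_induction {ι : Type*} {p : Multiplicative (ι →₀ ℤ) → Prop}
    (one : p 1) (mul : ∀ f g, p f → p g → p (f * g))
    (gen : ∀ i, p (Multiplicative.ofAdd (Finsupp.single i 1)))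
    (inv : ∀ f, p f → p f⁻¹) (f : Multiplicative (ι →₀ ℤ)) : p f := by
  have single (i : ι) (n : ℤ) : p (Multiplicative.ofAdd (Finsupp.single i n)) := by
    have key : Multiplicative.ofAdd (Finsupp.single i n) =
        Multiplicative.ofAdd (Finsupp.single i (1 : ℤ)) ^ n := by
      rw [← ofAdd_zsmul, Finsupp.smul_single, smul_eq_mul, mul_one]
    have pow (m : ℕ) : p (Multiplicative.ofAdd (Finsupp.single i (1 : ℤ)) ^ m) := by
      induction m with
      | zero => simpa using one
      | succ m ih => rw [pow_succ]; exact mul _ _ ih (gen i)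
    rw [key]
    obtain ⟨m, rfl | rfl⟩ := n.eq_nat_or_neg
    · simpa using pow m
    · simpa using inv _ (pow m)
  refine Finsupp.induction_linear (motive := fun f => p (Multiplicative.ofAdd f)) f.toAdd
    one (fun f g hf hg => mul _ _ hf hg) single

theorem range_eq_closure_of_apply_single {ι G : Type*} [Group G] {b : ι → G}
    {Φ : Multiplicative (ι →₀ ℤ) →* G}
    (hΦ : ∀ i, Φ (Multiplicative.ofAdd (Finsupp.single i 1)) = b i) :
    Φ.range = Subgroup.closure (Set.range b) := by
  apply le_antisymm
  · rintro _ ⟨f, rfl⟩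
    refine freeAbelian_induction (p := fun f => Φ f ∈ Subgroup.closure (Set.range b))
      ?_ ?_ ?_ ?_ f
    · simp
    · intro f g hf hg
      rw [map_mul]
      exact mul_mem hf hg
    · intro i
      rw [hΦ]
      exact Subgroup.subset_closure (Set.mem_range_self i)
    · intro f hf
      rw [map_inv]
      exact inv_mem hf
  · rw [Subgroup.closure_le]
    rintro _ ⟨i, rfl⟩
    exact ⟨_, hΦ i⟩

theorem shiftHom_apply_single (n k : ℤ) :
    shiftHom (Multiplicative.ofAdd n) (Multiplicative.ofAdd (Finsupp.single k 1)) =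
      Multiplicative.ofAdd (Finsupp.single (k + n) 1) := by
  change Multiplicative.ofAdd (shiftAut n (Finsupp.single k 1)) = _
  simp [shiftAut, Finsupp.domCongr_apply, Finsupp.equivMapDomain_single]

/-- A homomorphism of the base of `ℤ ≀ ℤ` intertwining the shift with conjugation by `a` extends
to `ℤ ≀ ℤ`. -/
theorem exists_wreath_hom {G : Type*} [Group G] {a : G} {b : ℤ → G}
    (hab : ∀ k n, a ^ n * b k * (a ^ n)⁻¹ = b (k + n))
    {Φ : Multiplicative (ℤ →₀ ℤ) →* G}
    (hΦ : ∀ i, Φ (Multiplicative.ofAdd (Finsupp.single i 1)) = b i) :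
    ∃ Ψ : ZwrZ →* G, ∀ x : ZwrZ, Ψ x = Φ x.left * a ^ x.right.toAdd := by
  refine ⟨SemidirectProduct.lift Φ (zpowersHom G a) ?_, fun x => rfl⟩
  intro n
  refine MonoidHom.ext fun f => ?_
  change Φ (shiftHom n f) = a ^ n.toAdd * Φ f * (a ^ n.toAdd)⁻¹
  refine freeAbelian_induction
    (p := fun f => Φ (shiftHom n f) = a ^ n.toAdd * Φ f * (a ^ n.toAdd)⁻¹) ?_ ?_ ?_ ?_ f
  · simp
  · intro f g hf hg
    rw [map_mul, map_mul, hf, hg, map_mul]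
    group
  · intro i
    rw [hΦ, hab, ← hΦ]
    exact congrArg Φ (shiftHom_apply_single n.toAdd i)
  · intro f hf
    rw [map_inv, map_inv, hf, map_inv]
    group

theorem perm_inv_strictMono {p : Equiv.Perm ℝ} (hp : StrictMono p) : StrictMono ⇑p⁻¹ := by
  intro x y hxy
  rw [← hp.lt_iff_lt]
  simpa using hxy

theorem perm_zpow_strictMono {p : Equiv.Perm ℝ} (hp : StrictMono p) (n : ℤ) :
    StrictMono ⇑(p ^ n) := by
  have pow {q : Equiv.Perm ℝ} (hq : StrictMono q) (m : ℕ) : StrictMono ⇑(q ^ m) := by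
    rw [Equiv.Perm.coe_pow]
    exact hq.iterate m
  obtain ⟨m, rfl | rfl⟩ := n.eq_nat_or_neg
  · simpa using pow hp m
  · simpa using pow (perm_inv_strictMono hp) m

theorem perm_zpow_apply_strictMono {p : Equiv.Perm ℝ} (hp : StrictMono p) {x : ℝ}
    (hx : x < p x) : StrictMono fun n : ℤ => (p ^ n) x := by
  refine strictMono_int_of_lt_succ fun n => ?_
  rw [zpow_add_one, Equiv.Perm.mul_apply]
  exact perm_zpow_strictMono hp n hx

theorem memF.strictMono_s8 {r : ℝ} {L A : Set ℝ} {f : Equiv.Perm ℝ} (hf : memF r L A f) :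
    StrictMono f := by
  rcases hf.2.1.strictMono_of_inj f.injective with h | h
  · exact h
  · have h1 : f (-1) = -1 := hf.1 _ fun h => by linarith [h.1]
    have h2 : f (-2) = -2 := hf.1 _ fun h => by linarith [h.1]
    have h3 : f (-1) < f (-2) := h (by norm_num)
    rw [h1, h2] at h3
    norm_num at h3

theorem zpow_apply_mem_psupp {f : Equiv.Perm ℝ} {x : ℝ} (hx : x ∈ psupp f) (n : ℤ) :
    (f ^ n) x ∈ psupp f := by
  change f ((f ^ n) x) ≠ (f ^ n) x
  rw [← Equiv.Perm.mul_apply, ← zpow_one_add, add_comm, zpow_add_one, Equiv.Perm.mul_apply]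
  exact (f ^ n).injective.ne hx

theorem commute_of_disjoint_psupp {f g : Equiv.Perm ℝ} (h : Disjoint (psupp f) (psupp g)) :
    f * g = g * f :=
  Equiv.Perm.Disjoint.commute fun x => by
    by_contra! hx
    exact Set.disjoint_left.mp h hx.1 hx.2

/-- On the support of `b k`, an element of the group generated by a family with disjoint supports
acts as a power of `b k`. -/
theorem apply_of_mem_psupp {b : ℤ → Equiv.Perm ℝ}
    (hd : ∀ k l, k ≠ l → Disjoint (psupp (b k)) (psupp (b l)))
    {Φ : Multiplicative (ℤ →₀ ℤ) →* Equiv.Perm ℝ}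
    (hΦ : ∀ i, Φ (Multiplicative.ofAdd (Finsupp.single i 1)) = b i) (k : ℤ)
    (f : Multiplicative (ℤ →₀ ℤ)) : ∀ x ∈ psupp (b k), Φ f x = (b k ^ (f.toAdd k)) x := by
  refine freeAbelian_induction
    (p := fun f => ∀ x ∈ psupp (b k), Φ f x = (b k ^ (f.toAdd k)) x) ?_ ?_ ?_ ?_ f
  · simp
  · intro f g hf hg x hx
    rw [map_mul, Equiv.Perm.mul_apply, hg x hx, hf _ (zpow_apply_mem_psupp hx _), toAdd_mul,
      Finsupp.add_apply, zpow_add, Equiv.Perm.mul_apply]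
  · intro l x hx
    rw [hΦ, toAdd_ofAdd]
    by_cases hlk : l = k
    · subst hlk
      simp
    · have hxl : x ∉ psupp (b l) := Set.disjoint_right.mp (hd l k hlk) hx
      rw [Finsupp.single_eq_of_ne (Ne.symm hlk), zpow_zero]
      exact not_not.mp hxl
  · intro f hf x hx
    rw [map_inv, Equiv.Perm.inv_eq_iff_eq, hf _ ?_]
    · simp
    · simpa using zpow_apply_mem_psupp hx (-f.toAdd k)

theorem injective_of_disjoint_psupp {b : ℤ → Equiv.Perm ℝ}
    (hd : ∀ k l, k ≠ l → Disjoint (psupp (b k)) (psupp (b l)))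
    (hmono : ∀ k, StrictMono (b k)) (hmove : ∀ k, ∃ x, x < b k x)
    {Φ : Multiplicative (ℤ →₀ ℤ) →* Equiv.Perm ℝ}
    (hΦ : ∀ i, Φ (Multiplicative.ofAdd (Finsupp.single i 1)) = b i) :
    Function.Injective Φ := by
  rw [injective_iff_map_eq_one]
  intro f hf
  refine Multiplicative.toAdd.injective (Finsupp.ext fun k => ?_)
  obtain ⟨x, hx⟩ := hmove k
  have h := apply_of_mem_psupp hd hΦ k f x hx.ne'
  rw [hf] at h
  exact ((perm_zpow_apply_strictMono (hmono k) hx).injective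
    (h.symm.trans (by simp) : (b k ^ (f.toAdd k)) x = (b k ^ (0 : ℤ)) x))

theorem psupp_conj (g f : Equiv.Perm ℝ) (hg : StrictMono g) {u v : ℝ} (hf : psupp f = Ioo u v) :
    psupp (g * f * g⁻¹) = Ioo (g u) (g v) := by
  ext x
  obtain ⟨y, rfl⟩ := g.surjective x
  have hy : y ∈ psupp f ↔ y ∈ Ioo u v := by rw [hf]
  simpa [psupp, hg.lt_iff_lt] using hy

/-- Let `a ∈ F↑` with `supp a = (0,r)`, `α₀ ∈ (0,r) ∩ A`,
`αₖ = aᵏ(α₀)`, and `b ∈ F↑` with `supp b = (α₀,α₁)`; write `bₖ = a⁻ᵏ b aᵏ`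
(with the paper's right-action convention; in terms of left actions this is
`bₖ = aᵏ ∘ b ∘ a⁻ᵏ`).  Then: (i) `supp bₖ = (αₖ, αₖ₊₁)`, and these supports are
pairwise disjoint; (ii) `N = ⟨bₖ : k ∈ ℤ⟩` is free abelian with basis `(bₖ)`;
(iii) `N ∩ ⟨a⟩ = {1}` and `⟨a⟩` is infinite cyclic; (iv) conjugation by `a` sends
`bₖ` to `bₖ₊₁`, `N` is normal in `⟨a,b⟩` and `⟨a,b⟩ = N ⋊ ⟨a⟩`.  In particular,
`⟨a,b⟩` is isomorphic to the restricted wreath product `ℤ ≀ ℤ = (⨁_{k∈ℤ} ℤ) ⋊ ℤ`,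
with `ℤ` acting by shifting the coordinates. -/
theorem wreath_product_inside_F (r : ℝ) (L A : Set ℝ) (hr : 0 < r)
    (hL : IsSlopeSubgroup L) (hLne : L ≠ {1}) (hA : IsSlopeModule r L A)
    (a b : Equiv.Perm ℝ)
    (ha : memF r L A a) (haup : ∀ x ∈ Ico (0:ℝ) r, x ≤ a x)
    (hsa : psupp a = Ioo 0 r)
    (α₀ : ℝ) (hα₀ : α₀ ∈ Ioo 0 r ∩ A)
    (αs : ℤ → ℝ) (hαs : ∀ k : ℤ, αs k = (a ^ k) α₀)
    (hb : memF r L A b) (hbup : ∀ x ∈ Ico (0:ℝ) r, x ≤ b x)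
    (hsb : psupp b = Ioo (αs 0) (αs 1))
    (bk : ℤ → Equiv.Perm ℝ) (hbk : ∀ k : ℤ, bk k = a ^ k * b * a ^ (-k)) :
    -- (i)
    (∀ k : ℤ, psupp (bk k) = Ioo (αs k) (αs (k + 1))) ∧
    (∀ k l : ℤ, k ≠ l → Disjoint (psupp (bk k)) (psupp (bk l))) ∧
    -- (ii) : `N` is free abelian with basis `(bₖ)_{k∈ℤ}`
    (∃ e : ↥(Subgroup.closure (Set.range bk)) ≃* Multiplicative (ℤ →₀ ℤ),
      ∀ k : ℤ, e ⟨bk k, Subgroup.subset_closure (Set.mem_range_self k)⟩ =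
        Multiplicative.ofAdd (Finsupp.single k 1)) ∧
    -- (iii)
    (Subgroup.closure (Set.range bk) ⊓ Subgroup.zpowers a = ⊥) ∧
    (Function.Injective fun n : ℤ => a ^ n) ∧
    -- (iv)
    (∀ k : ℤ, a * bk k * a⁻¹ = bk (k + 1)) ∧
    (∀ g ∈ Subgroup.closure ({a, b} : Set (Equiv.Perm ℝ)),
      ∀ x ∈ Subgroup.closure (Set.range bk),
        g * x * g⁻¹ ∈ Subgroup.closure (Set.range bk)) ∧
    (∀ g : Equiv.Perm ℝ, g ∈ Subgroup.closure ({a, b} : Set (Equiv.Perm ℝ)) ↔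
      ∃! p : Equiv.Perm ℝ × ℤ,
        p.1 ∈ Subgroup.closure (Set.range bk) ∧ g = p.1 * a ^ p.2) ∧
    -- in particular, `⟨a,b⟩ ≅ ℤ ≀ ℤ`
    Nonempty (↥(Subgroup.closure ({a, b} : Set (Equiv.Perm ℝ))) ≃* ZwrZ) := by
  have ma := ha.strictMono_s8
  have mb := hb.strictMono_s8
  have hlt : α₀ < a α₀ := lt_of_le_of_ne (haup α₀ ⟨hα₀.1.1.le, hα₀.1.2⟩)
    (Ne.symm (show α₀ ∈ psupp a from hsa ▸ hα₀.1))
  have hαfun : αs = fun k => (a ^ k) α₀ := funext hαs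
  have mα : StrictMono αs := hαfun ▸ perm_zpow_apply_strictMono ma hlt
  have hshift (k l : ℤ) : (a ^ k) (αs l) = αs (k + l) := by
    rw [hαs, hαs, zpow_add, Equiv.Perm.mul_apply]
  have hsupp (k : ℤ) : psupp (bk k) = Ioo (αs k) (αs (k + 1)) := by
    rw [hbk, zpow_neg, psupp_conj _ _ (perm_zpow_strictMono ma k) hsb, hshift, hshift, add_zero]
  have hdisj (k l : ℤ) (hkl : k ≠ l) : Disjoint (psupp (bk k)) (psupp (bk l)) := by
    rw [hsupp, hsupp, Set.disjoint_left]
    rintro x ⟨h1, h2⟩ ⟨h3, h4⟩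
    have h5 := mα.lt_iff_lt.mp (h1.trans h4)
    have h6 := mα.lt_iff_lt.mp (h3.trans h2)
    omega
  have hmono (k : ℤ) : StrictMono (bk k) := by
    rw [hbk]
    exact ((perm_zpow_strictMono ma k).comp mb).comp (perm_zpow_strictMono ma (-k))
  have hmove (k : ℤ) : ∃ x, x < bk k x := by
    obtain ⟨y, hy⟩ := exists_between (mα zero_lt_one)
    have hyb : y ∈ psupp b := hsb ▸ hy
    have hy' : y ∈ Ico 0 r := by
      by_contra h
      exact hyb (hb.1 y h)
    refine ⟨(a ^ k) y, ?_⟩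
    have : bk k ((a ^ k) y) = (a ^ k) (b y) := by simp [hbk]
    rw [this]
    exact perm_zpow_strictMono ma k (lt_of_le_of_ne (hbup y hy') (Ne.symm hyb))
  have hcomm (k l : ℤ) : bk k * bk l = bk l * bk k := by
    by_cases hkl : k = l
    · rw [hkl]
    · exact commute_of_disjoint_psupp (hdisj k l hkl)
  have hconj (k n : ℤ) : a ^ n * bk k * (a ^ n)⁻¹ = bk (k + n) := by
    rw [hbk, hbk, add_comm k n, neg_add_rev, zpow_add, zpow_add]
    group
  obtain ⟨Φ, hΦ⟩ := exists_hom_of_pairwise_commute bk hcomm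
  have hΦinj := injective_of_disjoint_psupp hdisj hmono hmove hΦ
  have hΦrange := range_eq_closure_of_apply_single hΦ
  have hΦmem (f) : Φ f ∈ Subgroup.closure (Set.range bk) := hΦrange ▸ ⟨f, rfl⟩
  obtain ⟨Ψ, hΨ⟩ := exists_wreath_hom hconj hΦ
  have hfix : ∀ x ∈ Subgroup.closure (Set.range bk), x α₀ = α₀ := by
    intro x hx
    change x ∈ MulAction.stabilizer (Equiv.Perm ℝ) α₀
    revert x
    change Subgroup.closure (Set.range bk) ≤ _
    rw [Subgroup.closure_le]
    rintro _ ⟨k, rfl⟩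
    have h0 : α₀ = αs 0 := by simp [hαs]
    have : α₀ ∉ psupp (bk k) := by
      rw [hsupp, h0]
      rintro ⟨h1, h2⟩
      have h3 := mα.lt_iff_lt.mp h1
      have h4 := mα.lt_iff_lt.mp h2
      omega
    exact not_not.mp this
  have hpow (n : ℤ) (hn : a ^ n ∈ Subgroup.closure (Set.range bk)) : n = 0 := by
    apply mα.injective
    rw [hαs, hαs, hfix _ hn, zpow_zero, Equiv.Perm.one_apply]
  have hΨinj : Function.Injective Ψ := by
    rw [injective_iff_map_eq_one]
    intro x hx
    rw [hΨ, mul_eq_one_iff_inv_eq] at hx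
    have hn : x.right.toAdd = 0 := hpow _ (hx ▸ inv_mem (hΦmem _))
    rw [hn, zpow_zero, inv_eq_one, map_eq_one_iff Φ hΦinj] at hx
    exact SemidirectProduct.ext hx (Multiplicative.toAdd.injective hn)
  have haG : a ∈ Subgroup.closure ({a, b} : Set (Equiv.Perm ℝ)) :=
    Subgroup.subset_closure (by simp)
  have hbG : b ∈ Subgroup.closure ({a, b} : Set (Equiv.Perm ℝ)) :=
    Subgroup.subset_closure (by simp)
  have hb0 : bk 0 = b := by simp [hbk]
  have hNG : Subgroup.closure (Set.range bk) ≤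
      Subgroup.closure ({a, b} : Set (Equiv.Perm ℝ)) := by
    rw [Subgroup.closure_le]
    rintro _ ⟨k, rfl⟩
    rw [hbk]
    exact mul_mem (mul_mem (zpow_mem haG _) hbG) (zpow_mem haG _)
  have hΨrange : Ψ.range = Subgroup.closure ({a, b} : Set (Equiv.Perm ℝ)) := by
    apply le_antisymm
    · rintro _ ⟨x, rfl⟩
      rw [hΨ]
      exact mul_mem (hNG (hΦmem _)) (zpow_mem haG _)
    · rw [Subgroup.closure_le]
      rintro x (rfl | rfl)
      · exact ⟨wa, by simp [hΨ, wa]⟩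
      · exact ⟨wb, by simp [hΨ, wb, hΦ, hb0]⟩
  have hinl (f) : Ψ (SemidirectProduct.inl f) = Φ f := by simp [hΨ]
  refine ⟨hsupp, hdisj, ?_, ?_, ?_, ?_, ?_, ?_, ?_⟩
  · let e := (MonoidHom.ofInjective hΦinj).trans (MulEquiv.subgroupCongr hΦrange)
    refine ⟨e.symm, fun k => ?_⟩
    rw [MulEquiv.symm_apply_eq]
    exact Subtype.ext (hΦ k).symm
  · rw [eq_bot_iff]
    rintro x ⟨hx, n, rfl⟩
    have : n = 0 := hpow n hx
    simp [this]
  · intro m n hmn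
    apply mα.injective
    rw [hαs, hαs]
    exact congrArg (fun g : Equiv.Perm ℝ => g α₀) hmn
  · intro k
    simpa using hconj k 1
  · rw [← hΨrange, ← hΦrange]
    rintro _ ⟨g, rfl⟩ _ ⟨f, rfl⟩
    have hmem : g * SemidirectProduct.inl f * g⁻¹ ∈
        (SemidirectProduct.rightHom : ZwrZ →* Multiplicative ℤ).ker := by
      simp [MonoidHom.mem_ker]
    rw [← SemidirectProduct.range_inl_eq_ker_rightHom] at hmem
    obtain ⟨f', hf'⟩ := hmem
    refine ⟨f', ?_⟩
    rw [← hinl, ← hinl, hf', map_mul, map_mul, map_inv]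
  · intro g
    constructor
    · rw [← hΨrange]
      rintro ⟨x, rfl⟩
      refine ⟨(Φ x.left, x.right.toAdd), ⟨hΦmem _, hΨ x⟩, ?_⟩
      rintro ⟨y, n⟩ ⟨hy, hyn⟩
      rw [← hΦrange] at hy
      obtain ⟨f, rfl⟩ := hy
      have : x = ⟨f, Multiplicative.ofAdd n⟩ := hΨinj (by rw [hyn, hΨ ⟨f, _⟩]; rfl)
      subst this
      rfl
    · rintro ⟨p, ⟨hp, rfl⟩, -⟩
      exact mul_mem (hNG hp) (zpow_mem haG _)
  · exact ⟨((MonoidHom.ofInjective hΨinj).trans (MulEquiv.subgroupCongr hΨrange)).symm⟩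
end

section
/- Let a ∈ F↑ with supp(a) = (0,r), let α₀ ∈ (0,r) ∩ A, set αₖ = aᵏ(α₀) for k ∈ ℤ, and let b ∈ F↑ with supp(b) = (α₀,α₁). Let G be a subgroup of V(r, ℝ*₊, ℝ) such that G ∩ F(r, ℝ*₊, ℝ) = F(r,Λ,A). Then the centralizer of a in G equals the centralizer of a in F = F(r,Λ,A), and the centralizer in G of the set {a⁻ᵏ b aᵏ : k ∈ ℤ} equals its centralizer in F. -/
open Set

/-- Membership in the group `V(r,L,A)`: permutations of `ℝ` fixing the complement
of `[0,r)` pointwise, right-continuous at every point, and piecewise affine with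
finitely many points of cut or singularity, all slopes in `L`, and all such points
and their images in `A`. -/
def memV (r : ℝ) (L A : Set ℝ) (f : Equiv.Perm ℝ) : Prop :=
  (∀ x : ℝ, x ∉ Ico (0:ℝ) r → f x = x) ∧
  (∀ x : ℝ, ContinuousWithinAt (⇑f) (Ici x) x) ∧
  PiecewiseAffine r L A f

/-- A continuous permutation of `ℝ` fixing everything outside `[0,r)` is increasing. -/
theorem Equiv.Perm.strictMono_of_continuous_of_fixes {r : ℝ} {f : Equiv.Perm ℝ}
    (hf : Continuous f) (hfix : ∀ x ∉ Ico (0:ℝ) r, f x = x) : StrictMono f := by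
  refine (hf.strictMono_of_inj f.injective).resolve_right fun h => ?_
  have h1 : f (-1) = -1 := hfix _ (by simp)
  have h2 : f (-2) = -2 := hfix _ (by simp)
  have := h (show (-2:ℝ) < -1 by norm_num)
  linarith

theorem StrictMono.perm_symm {α : Type*} [LinearOrder α] {f : Equiv.Perm α} (hf : StrictMono f) :
    StrictMono (f⁻¹ : Equiv.Perm α) := fun x y h => by
  rw [← hf.lt_iff_lt]
  simpa using h

theorem StrictMono.perm_zpow {α : Type*} [LinearOrder α] {f : Equiv.Perm α} (hf : StrictMono f)
    (k : ℤ) : StrictMono (f ^ k : Equiv.Perm α) := by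
  induction k using Int.induction_on with
  | zero => simpa using strictMono_id
  | succ n ih =>
    rw [zpow_add_one, Equiv.Perm.coe_mul]
    exact ih.comp hf
  | pred n ih =>
    rw [zpow_sub_one, Equiv.Perm.coe_mul]
    exact ih.comp hf.perm_symm

theorem StrictMono.perm_continuous {α : Type*} [LinearOrder α] [TopologicalSpace α]
    [OrderTopology α] [DenselyOrdered α] {f : Equiv.Perm α} (hf : StrictMono f) : Continuous f :=
  hf.monotone.continuous_of_surjective f.surjective

theorem apply_mem_psupp_iff_of_commute {c g : Equiv.Perm ℝ} (h : Commute c g) {x : ℝ} :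
    g x ∈ psupp c ↔ x ∈ psupp c := by
  have hx : c (g x) = g (c x) := DFunLike.congr_fun h.eq x
  simp [psupp, hx]

/-- A permutation that is continuous at all but finitely many points and commutes with an
increasing permutation `c` is continuous at every point that `c` moves up. -/
theorem continuousAt_of_commute {c g : Equiv.Perm ℝ} (hc : StrictMono c) (hcg : Commute c g)
    (hfin : {x | ¬ ContinuousAt g x}.Finite) {x : ℝ} (hx : x < c x) : ContinuousAt g x := by
  by_contra hg
  have hmono : StrictMono fun n : ℕ => (c ^ n) x := by
    refine strictMono_nat_of_lt_succ fun n => ?_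
    rw [pow_succ, Equiv.Perm.mul_apply]
    exact hc.perm_zpow n hx
  refine Set.infinite_of_injective_forall_mem hmono.injective
    (fun n => show ¬ ContinuousAt g ((c ^ n) x) from fun hn => hg ?_) hfin
  have hcn : Continuous ((c ^ n : Equiv.Perm ℝ)) := (hc.perm_zpow n).perm_continuous
  have hcn' : Continuous ((c ^ n)⁻¹ : Equiv.Perm ℝ) :=
    (hc.perm_zpow n).perm_symm.perm_continuous
  have hg' : (g : ℝ → ℝ) = ((c ^ n)⁻¹ : Equiv.Perm ℝ) ∘ g ∘ (c ^ n : Equiv.Perm ℝ) := by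
    funext y
    have hy : (c ^ n) (g y) = g ((c ^ n) y) := DFunLike.congr_fun (hcg.pow_left n).eq y
    simp [← hy]
  rw [hg']
  exact hcn'.continuousAt.comp (ContinuousAt.comp hn hcn.continuousAt)

/-- A right-continuous permutation with finitely many discontinuities that commutes with an
increasing permutation moving up exactly the points of `(u,v)` fixes `u` and is increasing
on `(u,v)`. -/
theorem strictMonoOn_and_fixes_of_commute {c g : Equiv.Perm ℝ} {u v : ℝ} (huv : u < v)
    (hc : StrictMono c) (hup : ∀ x, x ≤ c x) (hsupp : psupp c = Ioo u v) (hcg : Commute c g)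
    (hfin : {x | ¬ ContinuousAt g x}.Finite) (hright : ContinuousWithinAt g (Ici u) u) :
    StrictMonoOn g (Ioo u v) ∧ (∀ x, g x ∈ Ioo u v ↔ x ∈ Ioo u v) ∧ g u = u := by
  have hlt : ∀ x ∈ Ioo u v, x < c x := fun x hx =>
    lt_of_le_of_ne (hup x) (Ne.symm (by rw [← hsupp] at hx; exact hx))
  have hmem : ∀ x, g x ∈ Ioo u v ↔ x ∈ Ioo u v := fun x => by
    rw [← hsupp]; exact apply_mem_psupp_iff_of_commute hcg
  have hcont : ContinuousOn g (Ioo u v) := fun x hx =>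
    (continuousAt_of_commute hc hcg hfin (hlt x hx)).continuousWithinAt
  have hmono : StrictMonoOn g (Ioo u v) := by
    refine (hcont.strictMonoOn_of_injOn_Ioo huv g.injective.injOn).resolve_right fun hanti => ?_
    obtain ⟨x, hx⟩ := nonempty_Ioo.2 huv
    have hcx : c x ∈ Ioo u v := by
      rw [← hsupp]
      rw [← hsupp] at hx
      exact (apply_mem_psupp_iff_of_commute (Commute.refl c)).2 hx
    have h1 := hanti hx hcx (hlt x hx)
    have h2 : c (g x) = g (c x) := DFunLike.congr_fun hcg.eq x
    exact absurd (hup (g x)) (by rw [h2]; exact not_le.2 h1)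
  refine ⟨hmono, hmem, ?_⟩
  have hlim : Filter.Tendsto g (nhdsWithin u (Ioi u)) (nhds (g u)) :=
    hright.mono_left (nhdsWithin_mono u Ioi_subset_Ici_self)
  have hge : u ≤ g u := by
    refine ge_of_tendsto hlim ?_
    filter_upwards [Ioo_mem_nhdsGT huv] with x hx
    exact ((hmem x).2 hx).1.le
  refine hge.eq_of_not_lt' fun hgt => ?_
  obtain ⟨x, hx⟩ := nonempty_Ioo.2 huv
  have hle : g u ≤ g x := by
    refine le_of_tendsto hlim ?_
    filter_upwards [Ioo_mem_nhdsGT hx.1] with y hy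
    exact (hmono ⟨hy.1, hy.2.trans hx.2⟩ hx hy.2).le
  have : g u ∈ Ioo u v := ⟨hgt, hle.trans_lt ((hmem x).2 hx).2⟩
  exact absurd ((hmem u).1 this).1 (lt_irrefl u)

theorem continuous_of_strictMonoOn_Ioo {r : ℝ} {g : Equiv.Perm ℝ}
    (hfix : ∀ x ∉ Ioo (0:ℝ) r, g x = x) (hmaps : MapsTo g (Ioo 0 r) (Ioo 0 r))
    (hmono : StrictMonoOn g (Ioo 0 r)) : Continuous g := by
  refine StrictMono.perm_continuous fun x y hxy => ?_
  by_cases hx : x ∈ Ioo 0 r <;> by_cases hy : y ∈ Ioo 0 r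
  · exact hmono hx hy hxy
  · rw [hfix y hy]
    have hry : r ≤ y := not_lt.1 fun h => hy ⟨hx.1.trans hxy, h⟩
    exact (hmaps hx).2.trans_le hry
  · rw [hfix x hx]
    have hx0 : x ≤ 0 := not_lt.1 fun h => hx ⟨h, hxy.trans hy.2⟩
    exact hx0.trans_lt (hmaps hy).1
  · rwa [hfix x hx, hfix y hy]

theorem memV.finite_setOf_not_continuousAt {r : ℝ} {L A : Set ℝ} {g : Equiv.Perm ℝ}
    (hg : memV r L A g) : {x | ¬ ContinuousAt g x}.Finite := by
  obtain ⟨-, -, B, -, -, hB⟩ := hg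
  refine B.finite_toSet.subset fun x hx => ?_
  by_contra hxB
  obtain ⟨ε, hε, k, -, m, hm⟩ := hB x hxB
  refine hx (ContinuousAt.congr (f := fun y => k * y + m) (by fun_prop) ?_)
  filter_upwards [Ioo_mem_nhds (by linarith : x - ε < x) (by linarith : x < x + ε)] with y hy
  exact (hm y hy).symm

/-- If `f` has no fixed point in `(u,v)`, every point of `(u,v)` lies in one of the intervals
delimited by an increasing full orbit of `f` in `(u,v)`. -/
theorem exists_int_mem_Ico_of_orbit {f : ℝ → ℝ} {u v : ℝ} (hf : Continuous f)
    (hne : ∀ x ∈ Ioo u v, f x ≠ x) {s : ℤ → ℝ} (hs : StrictMono s) (hsI : ∀ k, s k ∈ Ioo u v)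
    (hstep : ∀ k, s (k + 1) = f (s k)) {x : ℝ} (hx : x ∈ Ioo u v) :
    ∃ k, x ∈ Ico (s k) (s (k + 1)) := by
  have hup : ∃ k, x < s k := by
    by_contra! h
    have hbdd : BddAbove (range s) := ⟨x, by rintro _ ⟨k, rfl⟩; exact h k⟩
    have hlim := tendsto_atTop_ciSup hs.monotone hbdd
    refine hne (⨆ k, s k) ⟨(hsI 0).1.trans_le (le_ciSup hbdd 0), (ciSup_le h).trans_lt hx.2⟩ ?_
    have h1 := (hf.tendsto _).comp hlim
    have h2 := hlim.comp (Filter.tendsto_atTop_add_const_right Filter.atTop (1:ℤ) Filter.tendsto_id)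
    refine tendsto_nhds_unique h1 (h2.congr fun k => hstep k)
  have hdown : ∃ k, s k ≤ x := by
    by_contra! h
    have hbdd : BddBelow (range s) := ⟨x, by rintro _ ⟨k, rfl⟩; exact (h k).le⟩
    have hlim := tendsto_atBot_ciInf hs.monotone hbdd
    refine hne (⨅ k, s k) ⟨hx.1.trans_le (le_ciInf fun k => (h k).le),
      (ciInf_le hbdd 0).trans_lt (hsI 0).2⟩ ?_
    have h1 := (hf.tendsto _).comp hlim
    have h2 := hlim.comp (Filter.tendsto_atBot_add_const_right Filter.atBot (1:ℤ) Filter.tendsto_id)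
    refine tendsto_nhds_unique h1 (h2.congr fun k => hstep k)
  obtain ⟨K, hK⟩ := hup
  obtain ⟨k, hk, hmax⟩ := Int.exists_greatest_of_bdd (P := fun k => s k ≤ x)
    ⟨K, fun z hz => (hs.lt_iff_lt.1 (hz.trans_lt hK)).le⟩ hdown
  exact ⟨k, hk, not_le.1 fun h => absurd (hmax _ h) (by omega)⟩

/-- Let `a`, `b`, `αₖ` be as before, and let `G` be a subgroup of
`V(r,ℝ*₊,ℝ)` with `G ∩ F(r,ℝ*₊,ℝ) = F(r,Λ,A)`.  Then the centralizer of `a` in `G`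
equals the centralizer of `a` in `F = F(r,Λ,A)`, and the centralizer in `G` of
`{a⁻ᵏ b aᵏ : k ∈ ℤ}` equals its centralizer in `F`. -/
theorem centralizers_preserved (r : ℝ) (L A : Set ℝ) (hr : 0 < r)
    (hL : IsSlopeSubgroup L) (hLne : L ≠ {1}) (hA : IsSlopeModule r L A)
    (a b : Equiv.Perm ℝ)
    (ha : memF r L A a) (haup : ∀ x ∈ Ico (0:ℝ) r, x ≤ a x)
    (hsa : psupp a = Ioo 0 r)
    (α₀ : ℝ) (hα₀ : α₀ ∈ Ioo 0 r ∩ A)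
    (αs : ℤ → ℝ) (hαs : ∀ k : ℤ, αs k = (a ^ k) α₀)
    (hb : memF r L A b) (hbup : ∀ x ∈ Ico (0:ℝ) r, x ≤ b x)
    (hsb : psupp b = Ioo (αs 0) (αs 1))
    (G : Subgroup (Equiv.Perm ℝ))
    (hGV : ∀ g ∈ G, memV r (Ioi (0:ℝ)) univ g)
    (hGF : {g : Equiv.Perm ℝ | g ∈ G ∧ memF r (Ioi (0:ℝ)) univ g} =
      {g : Equiv.Perm ℝ | memF r L A g}) :
    ({g : Equiv.Perm ℝ | g ∈ G ∧ Commute a g} =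
      {g : Equiv.Perm ℝ | memF r L A g ∧ Commute a g}) ∧
    ({g : Equiv.Perm ℝ | g ∈ G ∧ ∀ k : ℤ, Commute (a ^ k * b * a ^ (-k)) g} =
      {g : Equiv.Perm ℝ | memF r L A g ∧
        ∀ k : ℤ, Commute (a ^ k * b * a ^ (-k)) g}) := by
  have amono : StrictMono a := Equiv.Perm.strictMono_of_continuous_of_fixes ha.2.1 ha.1
  have bmono : StrictMono b := Equiv.Perm.strictMono_of_continuous_of_fixes hb.2.1 hb.1
  have aup : ∀ x, x ≤ a x := fun x => by
    by_cases hx : x ∈ Ico 0 r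
    exacts [haup x hx, (ha.1 x hx).ge]
  have bup : ∀ x, x ≤ b x := fun x => by
    by_cases hx : x ∈ Ico 0 r
    exacts [hbup x hx, (hb.1 x hx).ge]
  have hinv : ∀ k : ℤ, ∀ x, (a ^ k) x ∈ Ioo 0 r ↔ x ∈ Ioo 0 r := fun k x => by
    rw [← hsa]
    exact apply_mem_psupp_iff_of_commute (Commute.self_zpow a k)
  have hstep : ∀ k, αs (k + 1) = a (αs k) := fun k => by
    rw [hαs, hαs, add_comm, zpow_one_add, Equiv.Perm.mul_apply]
  have hαI : ∀ k, αs k ∈ Ioo 0 r := fun k => by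
    rw [hαs, hinv]
    exact hα₀.1
  have hane : ∀ x ∈ Ioo 0 r, a x ≠ x := fun x hx => by rwa [← hsa] at hx
  have αmono : StrictMono αs := strictMono_int_of_lt_succ fun k => by
    rw [hstep]
    exact lt_of_le_of_ne (aup _) (hane _ (hαI k)).symm
  have toF : ∀ g ∈ G, Continuous g → memF r L A g := fun g hg hcont => by
    have hgV := hGV g hg
    have : g ∈ {g : Equiv.Perm ℝ | g ∈ G ∧ memF r (Ioi (0:ℝ)) univ g} :=
      ⟨hg, hgV.1, hcont, hgV.2.2⟩
    rwa [hGF] at this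
  have ofF : ∀ g, memF r L A g → g ∈ G := fun g hg => by
    have : g ∈ {g : Equiv.Perm ℝ | memF r L A g} := hg
    rw [← hGF] at this
    exact this.1
  have hfixes : ∀ g ∈ G, g 0 = 0 → ∀ x ∉ Ioo 0 r, g x = x := fun g hg h0 x hx => by
    rcases eq_or_ne x 0 with rfl | hx0
    · exact h0
    · exact (hGV g hg).1 x fun h => hx ⟨lt_of_le_of_ne h.1 hx0.symm, h.2⟩
  refine ⟨Set.ext fun g => ⟨fun ⟨hg, hag⟩ => ⟨toF g hg ?_, hag⟩,
    fun ⟨hg, hag⟩ => ⟨ofF g hg, hag⟩⟩, Set.ext fun g => ⟨fun ⟨hg, hbg⟩ => ⟨toF g hg ?_, hbg⟩,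
    fun ⟨hg, hbg⟩ => ⟨ofF g hg, hbg⟩⟩⟩
  · have hgV := hGV g hg
    obtain ⟨hmono, hmem, h0⟩ := strictMonoOn_and_fixes_of_commute hr amono aup hsa hag
      hgV.finite_setOf_not_continuousAt (hgV.2.1 0)
    exact continuous_of_strictMonoOn_Ioo (hfixes g hg h0) (fun x => (hmem x).2) hmono
  · have hgV := hGV g hg
    have hlocal : ∀ k, StrictMonoOn g (Ioo (αs k) (αs (k + 1))) ∧
        (∀ x, g x ∈ Ioo (αs k) (αs (k + 1)) ↔ x ∈ Ioo (αs k) (αs (k + 1))) ∧ g (αs k) = αs k := by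
      intro k
      have hinvapp : ∀ x, (a ^ k) ((a ^ (-k)) x) = x := fun x => by
        rw [← Equiv.Perm.mul_apply, ← zpow_add, add_neg_cancel, zpow_zero, Equiv.Perm.one_apply]
      refine strictMonoOn_and_fixes_of_commute (αmono (lt_add_one k))
        (((amono.perm_zpow k).comp bmono).comp (amono.perm_zpow (-k))) (fun x => ?_) ?_ (hbg k)
        hgV.finite_setOf_not_continuousAt (hgV.2.1 _)
      · have h := (amono.perm_zpow k).monotone (bup ((a ^ (-k)) x))
        rwa [hinvapp] at h
      · ext x
        have h1 : x ∈ psupp (a ^ k * b * a ^ (-k)) ↔ (a ^ (-k)) x ∈ psupp b := by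
          have : (a ^ k) (b ((a ^ (-k)) x)) = x ↔ b ((a ^ (-k)) x) = (a ^ (-k)) x := by
            conv_lhs => rhs; rw [← hinvapp x]
            exact (a ^ k).injective.eq_iff
          exact not_congr this
        have h2 : ∀ j, αs (k + j) = (a ^ k) (αs j) := fun j => by
          rw [hαs, hαs, zpow_add, Equiv.Perm.mul_apply]
        have h3 : αs k = (a ^ k) (αs 0) := by rw [← h2, add_zero]
        rw [h1, hsb, h2, h3, mem_Ioo, mem_Ioo, ← (amono.perm_zpow k).lt_iff_lt,
          ← (amono.perm_zpow k).lt_iff_lt (b := αs 1), hinvapp]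
    have hcover : ∀ x ∈ Ioo 0 r, ∃ k, x ∈ Ico (αs k) (αs (k + 1)) := fun x hx =>
      exists_int_mem_Ico_of_orbit ha.2.1 hane αmono hαI hstep hx
    have hIco : ∀ k, ∀ x ∈ Ico (αs k) (αs (k + 1)), g x ∈ Ico (αs k) (αs (k + 1)) := by
      intro k x hx
      obtain ⟨-, hmem, hfix⟩ := hlocal k
      rcases hx.1.eq_or_lt with rfl | h
      · rwa [hfix]
      · exact Ioo_subset_Ico_self ((hmem x).2 ⟨h, hx.2⟩)
    have hmaps : MapsTo g (Ioo 0 r) (Ioo 0 r) := fun x hx => by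
      obtain ⟨k, hk⟩ := hcover x hx
      exact ⟨(hαI k).1.trans_le (hIco k x hk).1, (hIco k x hk).2.trans (hαI (k + 1)).2⟩
    have hmono : StrictMonoOn g (Ioo 0 r) := by
      intro x hx y hy hxy
      obtain ⟨j, hj⟩ := hcover x hx
      obtain ⟨k, hk⟩ := hcover y hy
      have hjk : j < k + 1 := αmono.lt_iff_lt.1 ((hj.1.trans_lt hxy).trans hk.2)
      rcases (Int.lt_add_one_iff.1 hjk).eq_or_lt with rfl | hjk
      · obtain ⟨hmono, hmem, hfix⟩ := hlocal j
        have hy' : y ∈ Ioo (αs j) (αs (j + 1)) := ⟨hj.1.trans_lt hxy, hk.2⟩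
        rcases hj.1.eq_or_lt with rfl | h
        · rw [hfix]
          exact ((hmem y).2 hy').1
        · exact hmono ⟨h, hj.2⟩ hy' hxy
      · exact ((hIco j x hj).2.trans_le (αmono.monotone hjk)).trans_le (hIco k y hk).1
    refine continuous_of_strictMonoOn_Ioo (hfixes g hg ?_) hmaps hmono
    by_contra h0
    have hg0 : g 0 ∈ Ico 0 r := by
      by_contra h
      exact h0 (g.injective (hgV.1 _ h))
    obtain ⟨k, hk⟩ := hcover _ ⟨lt_of_le_of_ne hg0.1 (Ne.symm h0), hg0.2⟩
    obtain ⟨-, hmem, hfix⟩ := hlocal k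
    rcases hk.1.eq_or_lt with h | h
    · exact (hαI k).1.ne' (g.injective (hfix.trans h))
    · exact lt_asymm (hαI k).1 ((hmem 0).1 ⟨h, hk.2⟩).1
end
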